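/- arXiv:1801.05484 — 2 statements merged into one kernel-verified Lean document; each statement's English description precedes it below -/
import Mathlib

section
/- Let (X,d,μ) be a metric measure space, x₀ ∈ X, Q > 1, and suppose there exist constants C₀ > 0 and R₀ > 0 such that μ(B(x₀,r)) ≤ C₀ r^Q for each 0 < r < R₀. Then Mod_Q Γ(cl(B(x₀,r)), X \ B(x₀,R), X) ≤ C₁ (log(R/r))^{1−Q} whenever 0 < 2r < R < R₀, where C₁ depends only on C₀ and Q. -/
open MeasureTheory Metric Set ENNReal Filter

noncomputable section

/-- A curve in a metric space: a continuous map defined on a nonempty interval of `ℝ`. -/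
structure Curve (X : Type*) [MetricSpace X] where
  carrier : Set ℝ
  nonempty : carrier.Nonempty
  ordConn : carrier.OrdConnected
  toFun : ℝ → X
  cont : ContinuousOn toFun carrier

namespace Curve

variable {X : Type*} [MetricSpace X]

/-- The length of a curve, as the total variation of its parametrization. -/
def length (γ : Curve X) : ℝ≥0∞ := eVariationOn γ.toFun γ.carrier

/-- A curve is rectifiable if it has finite length. -/
def Rectifiable (γ : Curve X) : Prop := γ.length < ⊤

/-- A curve is locally rectifiable if its restriction to every compact subinterval of its
domain is rectifiable. -/
def LocallyRectifiable (γ : Curve X) : Prop :=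
  ∀ a b : ℝ, Set.Icc a b ⊆ γ.carrier → eVariationOn γ.toFun (Set.Icc a b) < ⊤

/-- The (lower) line integral `∫_γ ρ dl` of a nonnegative Borel function along a curve,
defined through partitions of the parameter interval: on each piece one takes the infimum
of `ρ` along the piece times the length (variation) of the piece. -/
def lineIntegral (γ : Curve X) (ρ : X → ℝ≥0∞) : ℝ≥0∞ :=
  ⨆ (n : ℕ) (t : ℕ → ℝ) (_ : ∀ i, i < n → t i ≤ t (i + 1)) (_ : ∀ i, i ≤ n → t i ∈ γ.carrier),
    ∑ i ∈ Finset.range n,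
      (⨅ s ∈ γ.carrier ∩ Set.Icc (t i) (t (i + 1)), ρ (γ.toFun s)) *
        eVariationOn γ.toFun (γ.carrier ∩ Set.Icc (t i) (t (i + 1)))

/-- `γ'` is a subcurve of `γ`: the restriction of `γ` to a subinterval of its domain. -/
def IsSubcurve (γ' γ : Curve X) : Prop :=
  γ'.carrier ⊆ γ.carrier ∧ Set.EqOn γ'.toFun γ.toFun γ'.carrier

end Curve

variable {X Y : Type*} [MetricSpace X] [MetricSpace Y]

/-- The family `Γ(E,F,U)` of all curves in the set `U` joining `E` and `F`. -/
def joiningCurves (E F U : Set X) : Set (Curve X) :=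
  {γ | γ.toFun '' γ.carrier ⊆ U ∧ (∃ s ∈ γ.carrier, γ.toFun s ∈ E) ∧
    ∃ t ∈ γ.carrier, γ.toFun t ∈ F}

/-- The `p`-modulus of a family of curves: the infimum of `∫ ρ^p dμ` over all nonnegative
Borel functions `ρ` with `∫_γ ρ dl ≥ 1` for every curve `γ` in the family. -/
def modulus [MeasurableSpace X] (μ : Measure X) (p : ℝ) (Γ : Set (Curve X)) : ℝ≥0∞ :=
  ⨅ (ρ : X → ℝ≥0∞) (_ : Measurable ρ) (_ : ∀ γ ∈ Γ, 1 ≤ γ.lineIntegral ρ),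
    ∫⁻ x, ρ x ^ p ∂μ

/-- Distance between two sets. -/
def setEDist (E F : Set X) : ℝ≥0∞ := ⨅ x ∈ E, EMetric.infEdist x F

/-- A continuum is a nonempty compact connected set. -/
def IsContinuum (E : Set X) : Prop := IsCompact E ∧ IsConnected E

/-- A metric measure space is `Q`-Loewner if the `Q`-modulus of the family of curves joining
two disjoint nondegenerate continua is bounded below in terms of their relative distance. -/
def IsLoewner (Q : ℝ) (Y : Type*) [MetricSpace Y] [MeasurableSpace Y] (ν : Measure Y) : Prop :=
  ∃ φ : ℝ → ℝ≥0∞, (∀ s t : ℝ, 0 < s → s ≤ t → φ t ≤ φ s) ∧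
    (∀ t : ℝ, 0 < t → 0 < φ t ∧ φ t < ⊤) ∧
    ∀ E F : Set Y, IsContinuum E → E.Nontrivial → IsContinuum F → F.Nontrivial →
      Disjoint E F → ∀ t : ℝ, 0 < t →
        setEDist E F ≤ ENNReal.ofReal t * min (EMetric.diam E) (EMetric.diam F) →
        φ t ≤ modulus ν Q (joiningCurves E F Set.univ)

/-- A metric measure space is of locally `Q`-bounded geometry if it is separable, pathwise
connected, locally compact, and each point has a relatively compact neighbourhood on which
balls have at most Euclidean-type volume growth of exponent `Q` and the `Q`-modulus of curves
joining two continua in a ball is controlled from below by their relative distance. -/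
def LocBoundedGeom (Q : ℝ) (X : Type*) [MetricSpace X] [MeasurableSpace X]
    (μ : Measure X) : Prop :=
  TopologicalSpace.SeparableSpace X ∧ PathConnectedSpace X ∧ LocallyCompactSpace X ∧
  ∃ (C₀ lam : ℝ) (ψ : ℝ → ℝ≥0∞), 1 ≤ C₀ ∧ 0 < lam ∧ lam ≤ 1 ∧
    (∀ s t : ℝ, 0 < s → s ≤ t → ψ t ≤ ψ s) ∧ (∀ t : ℝ, 0 < t → 0 < ψ t ∧ ψ t < ⊤) ∧
    ∀ x₀ : X, ∃ U : Set X, U ∈ nhds x₀ ∧ IsCompact (closure U) ∧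
      (∀ r : ℝ, 0 < r → Metric.ball x₀ r ⊆ U →
        μ (Metric.ball x₀ r) ≤ ENNReal.ofReal (C₀ * r ^ Q)) ∧
      (∀ r : ℝ, 0 < r → Metric.ball x₀ r ⊆ U → ∀ E F : Set X,
        IsContinuum E → E.Nontrivial → IsContinuum F → F.Nontrivial → Disjoint E F →
        E ⊆ Metric.ball x₀ (lam * r) → F ⊆ Metric.ball x₀ (lam * r) →
        ∀ t : ℝ, 0 < t →
          setEDist E F ≤ ENNReal.ofReal t * min (EMetric.diam E) (EMetric.diam F) →
          ψ t ≤ modulus μ Q (joiningCurves E F (Metric.ball x₀ r)))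

/-- The local quasiconformality quotient of `f` at `x ∈ U` at scale `r`. -/
def qcQuot (f : X → Y) (U : Set X) (x : X) (r : ℝ) : ℝ≥0∞ :=
  (⨆ y ∈ {y | y ∈ U ∧ dist x y ≤ r}, edist (f x) (f y)) /
    ⨅ y ∈ {y | y ∈ U ∧ r ≤ dist x y}, edist (f x) (f y)

/-- Metric definition of quasiconformality: the linear dilatation is at most `H`
at every point of `U`. -/
def IsMetricQC (H : ℝ≥0∞) (f : X → Y) (U : Set X) : Prop :=
  ∀ x ∈ U, Filter.limsup (qcQuot f U x) (nhdsWithin 0 (Set.Ioi 0)) ≤ H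

/-- `f` is a homeomorphism of `U` onto `V`. -/
def IsHomeoOn (f : X → Y) (U : Set X) (V : Set Y) : Prop :=
  Set.BijOn f U V ∧ ContinuousOn f U ∧
    ∃ g : Y → X, Set.MapsTo g V U ∧ (∀ x ∈ U, g (f x) = x) ∧ ContinuousOn g V

/-- The family `f(Γ)` of image curves of a family `Γ` under a map `f`. -/
def mapFamily (f : X → Y) (Γ : Set (Curve X)) : Set (Curve Y) :=
  {γ' | ∃ γ ∈ Γ, γ'.carrier = γ.carrier ∧ ∀ t ∈ γ'.carrier, γ'.toFun t = f (γ.toFun t)}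

theorem exists_first_hitting {u : ℝ → ℝ} {a b c : ℝ} (hab : a ≤ b)
    (hu : ContinuousOn u (Icc a b)) (ha : u a ≤ c) (hb : c ≤ u b) :
    ∃ q ∈ Icc a b, u q = c ∧ ∀ x ∈ Icc a q, u x ≤ c := by
  have hS : IsCompact (Icc a b ∩ u ⁻¹' {c}) :=
    isCompact_Icc.of_isClosed_subset
      (hu.preimage_isClosed_of_isClosed isClosed_Icc isClosed_singleton) inter_subset_left
  obtain ⟨x₀, hx₀, hx₀c⟩ := intermediate_value_Icc hab hu ⟨ha, hb⟩
  obtain ⟨q, ⟨hq, hqc⟩, hmin⟩ := hS.exists_isLeast ⟨x₀, hx₀, hx₀c⟩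
  refine ⟨q, hq, hqc, fun x hx => ?_⟩
  by_contra! hlt
  obtain ⟨y, hy, hyc⟩ := intermediate_value_Icc hx.1
    (hu.mono (Icc_subset_Icc_right (hx.2.trans hq.2))) ⟨ha, hlt.le⟩
  have hqy : q ≤ y := hmin ⟨⟨hy.1, hy.2.trans (hx.2.trans hq.2)⟩, hyc⟩
  have hxy : x = y := le_antisymm (hx.2.trans hqy) hy.2
  rw [hxy, hyc] at hlt
  exact lt_irrefl _ hlt

theorem exists_last_hitting {u : ℝ → ℝ} {a b c : ℝ} (hab : a ≤ b)
    (hu : ContinuousOn u (Icc a b)) (ha : u a ≤ c) (hb : c ≤ u b) :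
    ∃ p ∈ Icc a b, u p = c ∧ ∀ x ∈ Icc p b, c ≤ u x := by
  have hv : ContinuousOn (fun x => -u (-x)) (Icc (-b) (-a)) :=
    (hu.comp continuousOn_neg fun x hx => ⟨by linarith [hx.2], by linarith [hx.1]⟩).neg
  obtain ⟨q, hq, hqc, h⟩ := exists_first_hitting (c := -c) (neg_le_neg hab) hv
    (by simpa using hb) (by simpa using ha)
  refine ⟨-q, ⟨by linarith [hq.2], by linarith [hq.1]⟩, neg_injective hqc, fun x hx => ?_⟩
  have := h (-x) ⟨by linarith [hx.2], by linarith [hx.1]⟩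
  simp only [neg_neg] at this
  linarith

/-- A continuous function climbing past the disjoint bands `[lo k, hi k]` crosses each of them,
and the crossings can be taken in order. -/
theorem exists_band_crossings {u : ℝ → ℝ} {a b : ℝ} (hab : a ≤ b)
    (hu : ContinuousOn u (Icc a b)) {N : ℕ} {lo hi : ℕ → ℝ}
    (hlohi : ∀ k, lo k < hi k) (hhilo : ∀ k, hi k < lo (k + 1))
    (ha : ∀ k < N, u a ≤ lo k) (hb : ∀ k < N, hi k ≤ u b) :
    ∃ p q : ℕ → ℝ, (∀ k < N, p k ∈ Icc a b ∧ q k ∈ Icc a b ∧ p k ≤ q k ∧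
      u (p k) = lo k ∧ u (q k) = hi k ∧ ∀ x ∈ Icc (p k) (q k), u x ∈ Icc (lo k) (hi k)) ∧
      ∀ k, k + 1 < N → q k ≤ p (k + 1) := by
  have hfirst : ∀ k, ∃ q, k < N → q ∈ Icc a b ∧ u q = hi k ∧ ∀ x ∈ Icc a q, u x ≤ hi k := by
    intro k
    by_cases hk : k < N
    · obtain ⟨q, hq, h⟩ := exists_first_hitting hab hu
        ((ha k hk).trans (hlohi k).le) (hb k hk)
      exact ⟨q, fun _ => ⟨hq, h⟩⟩
    · exact ⟨0, fun h => absurd h hk⟩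
  choose q hq using hfirst
  have hlast : ∀ k, ∃ p, k < N → p ∈ Icc a (q k) ∧ u p = lo k ∧
      ∀ x ∈ Icc p (q k), lo k ≤ u x := by
    intro k
    by_cases hk : k < N
    · obtain ⟨hqk, hqu, -⟩ := hq k hk
      obtain ⟨p, hp, h⟩ := exists_last_hitting hqk.1 (hu.mono (Icc_subset_Icc_right hqk.2))
        (ha k hk) (by rw [hqu]; exact (hlohi k).le)
      exact ⟨p, fun _ => ⟨hp, h⟩⟩
    · exact ⟨0, fun h => absurd h hk⟩
  choose p hp using hlast
  refine ⟨p, q, fun k hk => ?_, fun k hk => ?_⟩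
  · obtain ⟨hqk, hqu, hqle⟩ := hq k hk
    obtain ⟨hpk, hpu, hple⟩ := hp k hk
    exact ⟨⟨hpk.1, hpk.2.trans hqk.2⟩, hqk, hpk.2, hpu, hqu,
      fun x hx => ⟨hple x hx, hqle x ⟨hpk.1.trans hx.1, hx.2⟩⟩⟩
  · obtain ⟨hqk, hqu, hqle⟩ := hq k (by omega)
    obtain ⟨hqk', hqu', hqle'⟩ := hq (k + 1) hk
    obtain ⟨hpk, hpu, hple⟩ := hp (k + 1) hk
    have h₁ : q k ≤ q (k + 1) := by
      by_contra! h
      have := hqle _ ⟨hqk'.1, h.le⟩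
      linarith [hhilo k, hlohi (k + 1)]
    by_contra! h
    have := hple _ ⟨h.le, h₁⟩
    linarith [hhilo k]

theorem sum_range_even_le (f : ℕ → ℝ≥0∞) (M : ℕ) :
    ∑ k ∈ Finset.range (M + 1), f (2 * k) ≤ ∑ i ∈ Finset.range (2 * M + 1), f i := by
  induction M with
  | zero => simp
  | succ M ih =>
    rw [Finset.sum_range_succ, show 2 * (M + 1) + 1 = 2 * M + 1 + 1 + 1 by ring,
      Finset.sum_range_succ _ (2 * M + 1 + 1), Finset.sum_range_succ _ (2 * M + 1),
      show 2 * (M + 1) = 2 * M + 1 + 1 by ring]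
    gcongr
    exact ih.trans le_self_add

/-- Ordered pieces of a curve contribute additively to its line integral. -/
theorem Curve.sum_le_lineIntegral (γ : Curve X) (ρ : X → ℝ≥0∞) {N : ℕ} {p q : ℕ → ℝ}
    (hp : ∀ k < N, p k ∈ γ.carrier) (hq : ∀ k < N, q k ∈ γ.carrier)
    (hpq : ∀ k < N, p k ≤ q k) (hqp : ∀ k, k + 1 < N → q k ≤ p (k + 1)) :
    ∑ k ∈ Finset.range N, (⨅ s ∈ γ.carrier ∩ Icc (p k) (q k), ρ (γ.toFun s)) *
      eVariationOn γ.toFun (γ.carrier ∩ Icc (p k) (q k)) ≤ γ.lineIntegral ρ := by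
  obtain _ | M := N
  · simp
  set t : ℕ → ℝ := fun i => if i % 2 = 0 then p (i / 2) else q (i / 2) with ht
  have hp' : ∀ k, t (2 * k) = p k := fun k => by simp [ht]
  have hq' : ∀ k, t (2 * k + 1) = q k := fun k => by
    simp [ht, Nat.add_mod, show (2 * k + 1) / 2 = k by omega]
  have hmono : ∀ i, i < 2 * M + 1 → t i ≤ t (i + 1) := by
    intro i hi
    obtain ⟨k, rfl | rfl⟩ := Nat.even_or_odd' i
    · rw [hp', hq']
      exact hpq k (by omega)
    · rw [hq', show 2 * k + 1 + 1 = 2 * (k + 1) by ring, hp']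
      exact hqp k (by omega)
  have hmem : ∀ i, i ≤ 2 * M + 1 → t i ∈ γ.carrier := by
    intro i hi
    obtain ⟨k, rfl | rfl⟩ := Nat.even_or_odd' i
    · rw [hp']
      exact hp k (by omega)
    · rw [hq']
      exact hq k (by omega)
  refine le_trans ?_ ((sum_range_even_le (fun i =>
    (⨅ s ∈ γ.carrier ∩ Icc (t i) (t (i + 1)), ρ (γ.toFun s)) *
      eVariationOn γ.toFun (γ.carrier ∩ Icc (t i) (t (i + 1)))) M).trans ?_)
  · simp only [hp', hq', le_refl]
  · exact le_iSup₂_of_le (2 * M + 1) t (le_iSup₂_of_le hmono hmem le_rfl)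

/-- A curve passing from one side of a family of disjoint shells to the other crosses them in
order, one way or the other. -/
theorem Curve.exists_shell_crossings (γ : Curve X) (x₀ : X) {s t : ℝ} (hs : s ∈ γ.carrier)
    (ht : t ∈ γ.carrier) {N : ℕ} {lo hi : ℕ → ℝ}
    (hlohi : ∀ k, lo k < hi k) (hhilo : ∀ k, hi k < lo (k + 1))
    (hslo : ∀ k < N, dist (γ.toFun s) x₀ ≤ lo k) (hthi : ∀ k < N, hi k ≤ dist (γ.toFun t) x₀) :
    ∃ (p q : ℕ → ℝ) (σ : ℕ → ℕ), (∀ k < N, σ k < N) ∧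
      (∀ k < N, p k ∈ γ.carrier ∧ q k ∈ γ.carrier ∧ p k ≤ q k ∧
        hi (σ k) - lo (σ k) ≤ dist (γ.toFun (p k)) (γ.toFun (q k)) ∧
        ∀ x ∈ Icc (p k) (q k), dist (γ.toFun x) x₀ ∈ Icc (lo (σ k)) (hi (σ k))) ∧
      ∀ k, k + 1 < N → q k ≤ p (k + 1) := by
  have hu : ContinuousOn (fun τ => dist (γ.toFun τ) x₀) γ.carrier :=
    (continuous_id.dist continuous_const).comp_continuousOn γ.cont
  rcases le_total s t with hst | hts
  · have hsub := γ.ordConn.out hs ht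
    obtain ⟨p, q, h, hqp⟩ := exists_band_crossings hst (hu.mono hsub) hlohi hhilo hslo hthi
    refine ⟨p, q, id, fun k hk => hk, fun k hk => ?_, hqp⟩
    obtain ⟨hp, hq, hpq, hup, huq, hband⟩ := h k hk
    refine ⟨hsub hp, hsub hq, hpq, ?_, hband⟩
    have := dist_triangle (γ.toFun (q k)) (γ.toFun (p k)) x₀
    rw [dist_comm (γ.toFun (q k)) (γ.toFun (p k))] at this
    simp only [id]
    linarith
  · have hsub := γ.ordConn.out ht hs
    have hv : ContinuousOn (fun τ => dist (γ.toFun (-τ)) x₀) (Icc (-s) (-t)) :=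
      (hu.mono hsub).comp continuousOn_neg
        fun x hx => ⟨by linarith [hx.2], by linarith [hx.1]⟩
    obtain ⟨p, q, h, hqp⟩ := exists_band_crossings (neg_le_neg hts) hv hlohi hhilo
      (by simpa using hslo) (by simpa using hthi)
    refine ⟨fun k => -q (N - 1 - k), fun k => -p (N - 1 - k), fun k => N - 1 - k,
      fun k hk => by dsimp only; omega, fun k hk => ?_, fun k hk => ?_⟩
    · obtain ⟨hp, hq, hpq, hup, huq, hband⟩ := h (N - 1 - k) (by omega)
      refine ⟨hsub ⟨by linarith [hq.2], by linarith [hq.1]⟩,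
        hsub ⟨by linarith [hp.2], by linarith [hp.1]⟩, neg_le_neg hpq, ?_, fun x hx => ?_⟩
      · have := dist_triangle (γ.toFun (-q (N - 1 - k))) (γ.toFun (-p (N - 1 - k))) x₀
        linarith
      · simpa using hband (-x) ⟨by linarith [hx.2], by linarith [hx.1]⟩
    · have := hqp (N - 1 - (k + 1)) (by omega)
      rw [show N - 1 - (k + 1) + 1 = N - 1 - k by omega] at this
      exact neg_le_neg this

/-- The dyadic test function: on the shell `2 ^ k * r ≤ dist x x₀ ≤ 3 / 2 * (2 ^ k * r)`, `k < N`,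
it is the constant making a crossing of that shell contribute `1 / N`. -/
def dyadicDensity (x₀ : X) (r : ℝ) (N : ℕ) (x : X) : ℝ≥0∞ :=
  (Finset.range N).sup fun k =>
    {y | dist y x₀ ∈ Icc (2 ^ k * r) (3 / 2 * (2 ^ k * r))}.indicator
      (fun _ => ENNReal.ofReal (2 / (N * (2 ^ k * r)))) x

theorem measurableSet_shell [MeasurableSpace X] [BorelSpace X] (x₀ : X) (a b : ℝ) :
    MeasurableSet {y | dist y x₀ ∈ Icc a b} :=
  (isClosed_Icc.preimage (continuous_id.dist continuous_const)).measurableSet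

theorem measurable_dyadicDensity [MeasurableSpace X] [BorelSpace X] (x₀ : X) (r : ℝ) (N : ℕ) :
    Measurable (dyadicDensity x₀ r N) := by
  unfold dyadicDensity
  simp_rw [Finset.sup_eq_iSup]
  exact Measurable.iSup fun k => Measurable.iSup fun _ =>
    measurable_const.indicator (measurableSet_shell _ _ _)

theorem one_le_lineIntegral_dyadicDensity {x₀ : X} {r : ℝ} {N : ℕ} (hr : 0 < r) (hN : 0 < N)
    {R : ℝ} (hR : 2 ^ N * r ≤ R) {γ : Curve X}
    (hγ : γ ∈ joiningCurves (closure (ball x₀ r)) (ball x₀ R)ᶜ univ) :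
    1 ≤ γ.lineIntegral (dyadicDensity x₀ r N) := by
  obtain ⟨-, ⟨s, hs, hsE⟩, t, ht, htF⟩ := hγ
  have hsr : dist (γ.toFun s) x₀ ≤ r := closure_ball_subset_closedBall hsE
  have htR : R ≤ dist (γ.toFun t) x₀ := not_lt.1 htF
  have hpos : ∀ k : ℕ, 0 < 2 ^ k * r := fun k => by positivity
  obtain ⟨p, q, σ, hσ, h, hqp⟩ := γ.exists_shell_crossings x₀ hs ht (N := N)
    (lo := fun k => 2 ^ k * r) (hi := fun k => 3 / 2 * (2 ^ k * r))
    (fun k => by linarith [hpos k]) (fun k => by rw [pow_succ]; linarith [hpos k])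
    (fun k _ => hsr.trans (le_mul_of_one_le_left hr.le (one_le_pow₀ one_le_two)))
    (fun k hk => by
      have : (2 : ℝ) ^ (k + 1) * r ≤ 2 ^ N * r := by
        gcongr
        · exact one_le_two
        · exact hk
      rw [pow_succ] at this
      linarith [hpos k])
  refine le_trans ?_ (γ.sum_le_lineIntegral _ (fun k hk => (h k hk).1)
    (fun k hk => (h k hk).2.1) (fun k hk => (h k hk).2.2.1) hqp)
  have hterm : ∀ k ∈ Finset.range N, ENNReal.ofReal (1 / N) ≤
      (⨅ s ∈ γ.carrier ∩ Icc (p k) (q k), dyadicDensity x₀ r N (γ.toFun s)) *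
      eVariationOn γ.toFun (γ.carrier ∩ Icc (p k) (q k)) := by
    intro k hk
    obtain ⟨hp, hq, hpq, hd, hband⟩ := h k (Finset.mem_range.1 hk)
    have hinf : ENNReal.ofReal (2 / (N * (2 ^ σ k * r))) ≤
        ⨅ s ∈ γ.carrier ∩ Icc (p k) (q k), dyadicDensity x₀ r N (γ.toFun s) := by
      refine le_iInf₂ fun x hx => ?_
      refine le_trans (le_of_eq ?_) (Finset.le_sup (Finset.mem_range.2 (hσ k
        (Finset.mem_range.1 hk))))
      rw [indicator_of_mem]
      exact hband x hx.2
    have hvar : ENNReal.ofReal (2 ^ σ k * r / 2) ≤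
        eVariationOn γ.toFun (γ.carrier ∩ Icc (p k) (q k)) := by
      refine le_trans ?_ (eVariationOn.edist_le γ.toFun ⟨hp, left_mem_Icc.2 hpq⟩
        ⟨hq, right_mem_Icc.2 hpq⟩)
      rw [edist_dist]
      exact ENNReal.ofReal_le_ofReal (by linarith)
    refine le_trans (le_of_eq ?_) (mul_le_mul' hinf hvar)
    rw [← ENNReal.ofReal_mul (by positivity)]
    congr 1
    field_simp
  refine le_trans (le_of_eq ?_) (Finset.sum_le_sum hterm)
  rw [Finset.sum_const, Finset.card_range, nsmul_eq_mul, ← ENNReal.ofReal_natCast,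
    ← ENNReal.ofReal_mul (by positivity), mul_one_div_cancel (by positivity), ENNReal.ofReal_one]

theorem dyadicDensity_rpow_le (x₀ : X) (r : ℝ) {N : ℕ} (hN : 0 < N) {Q : ℝ} (hQ : 0 < Q) (x : X) :
    dyadicDensity x₀ r N x ^ Q ≤ ∑ k ∈ Finset.range N,
      {y | dist y x₀ ∈ Icc (2 ^ k * r) (3 / 2 * (2 ^ k * r))}.indicator
        (fun _ => ENNReal.ofReal (2 / (N * (2 ^ k * r))) ^ Q) x := by
  obtain ⟨k, hk, hsup⟩ := Finset.exists_mem_eq_sup (Finset.range N)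
    (Finset.nonempty_range_iff.2 hN.ne') fun k =>
      {y | dist y x₀ ∈ Icc (2 ^ k * r) (3 / 2 * (2 ^ k * r))}.indicator
        (fun _ => ENNReal.ofReal (2 / (N * (2 ^ k * r)))) x
  rw [dyadicDensity, hsup]
  refine le_trans ?_ (Finset.single_le_sum (fun _ _ => zero_le) hk)
  by_cases hx : x ∈ {y | dist y x₀ ∈ Icc (2 ^ k * r) (3 / 2 * (2 ^ k * r))}
  · simp only [indicator_of_mem hx, le_refl]
  · simp only [indicator_of_notMem hx, ENNReal.zero_rpow_of_pos hQ, le_refl]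

theorem lintegral_dyadicDensity_rpow_le [MeasurableSpace X] [BorelSpace X] {μ : Measure X}
    {x₀ : X} {Q C₀ R₀ : ℝ} (hQ : 0 < Q) (_hC₀ : 0 < C₀)
    (hμ : ∀ r : ℝ, 0 < r → r < R₀ → μ (ball x₀ r) ≤ ENNReal.ofReal (C₀ * r ^ Q))
    {r : ℝ} {N : ℕ} (hr : 0 < r) (hN : 0 < N) (hR₀ : 2 ^ N * r < R₀) :
    ∫⁻ x, dyadicDensity x₀ r N x ^ Q ∂μ ≤
      ENNReal.ofReal (C₀ * 4 ^ Q * (N : ℝ) ^ (1 - Q)) := by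
  have hN' : (0 : ℝ) < N := Nat.cast_pos.2 hN
  have hterm : ∀ k ∈ Finset.range N, ∫⁻ x,
      {y | dist y x₀ ∈ Icc (2 ^ k * r) (3 / 2 * (2 ^ k * r))}.indicator
        (fun _ => ENNReal.ofReal (2 / (N * (2 ^ k * r))) ^ Q) x ∂μ ≤
      ENNReal.ofReal (C₀ * (4 / N) ^ Q) := by
    intro k hk
    have hpos : 0 < 2 ^ k * r := by positivity
    have hle : (2 : ℝ) * (2 ^ k * r) ≤ 2 ^ N * r := by
      rw [← mul_assoc, ← pow_succ']
      gcongr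
      · exact one_le_two
      · exact Finset.mem_range.1 hk
    rw [lintegral_indicator_const (measurableSet_shell _ _ _),
      ENNReal.ofReal_rpow_of_nonneg (by positivity) hQ.le]
    have hshell : μ {y | dist y x₀ ∈ Icc (2 ^ k * r) (3 / 2 * (2 ^ k * r))} ≤
        ENNReal.ofReal (C₀ * (2 * (2 ^ k * r)) ^ Q) := by
      refine (measure_mono fun y hy => ?_).trans (hμ _ (by positivity) (hle.trans_lt hR₀))
      exact mem_ball.2 (by linarith [hy.2])
    refine (mul_le_mul' le_rfl hshell).trans (le_of_eq ?_)
    rw [← ENNReal.ofReal_mul (by positivity), mul_left_comm,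
      ← Real.mul_rpow (by positivity) (by positivity)]
    congr 3
    field_simp
    norm_num
  calc ∫⁻ x, dyadicDensity x₀ r N x ^ Q ∂μ
      ≤ ∫⁻ x, ∑ k ∈ Finset.range N,
          {y | dist y x₀ ∈ Icc (2 ^ k * r) (3 / 2 * (2 ^ k * r))}.indicator
            (fun _ => ENNReal.ofReal (2 / (N * (2 ^ k * r))) ^ Q) x ∂μ :=
        lintegral_mono fun x => dyadicDensity_rpow_le x₀ r hN hQ x
    _ = ∑ k ∈ Finset.range N, ∫⁻ x,
          {y | dist y x₀ ∈ Icc (2 ^ k * r) (3 / 2 * (2 ^ k * r))}.indicator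
            (fun _ => ENNReal.ofReal (2 / (N * (2 ^ k * r))) ^ Q) x ∂μ :=
        lintegral_finsetSum _ fun k _ =>
          measurable_const.indicator (measurableSet_shell _ _ _)
    _ ≤ ∑ _k ∈ Finset.range N, ENNReal.ofReal (C₀ * (4 / N) ^ Q) := Finset.sum_le_sum hterm
    _ = ENNReal.ofReal (C₀ * 4 ^ Q * (N : ℝ) ^ (1 - Q)) := by
        rw [Finset.sum_const, Finset.card_range, nsmul_eq_mul, ← ENNReal.ofReal_natCast,
          ← ENNReal.ofReal_mul hN'.le, Real.rpow_sub hN', Real.rpow_one,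
          Real.div_rpow (by norm_num) hN'.le]
        congr 1
        ring

/-- If `μ(B(x₀,r)) ≤ C₀ r^Q` for `0 < r < R₀` (with `Q > 1`), then
`Mod_Q Γ(cl B(x₀,r), X \ B(x₀,R), X) ≤ C₁ (log (R/r))^{1-Q}` whenever `0 < 2r < R < R₀`,
where `C₁ > 0` depends only on `C₀` and `Q`. -/
theorem modulus_annulus_bound (Q C₀ : ℝ) (hQ : 1 < Q) (hC₀ : 0 < C₀) :
    ∃ C₁ : ℝ, 0 < C₁ ∧
      ∀ (X : Type) [MetricSpace X] [TopologicalSpace.SeparableSpace X]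
        [MeasurableSpace X] [BorelSpace X]
        (μ : Measure X) [IsLocallyFiniteMeasure μ] (x₀ : X) (R₀ : ℝ), 0 < R₀ →
        (∀ r : ℝ, 0 < r → r < R₀ → μ (Metric.ball x₀ r) ≤ ENNReal.ofReal (C₀ * r ^ Q)) →
        ∀ r R : ℝ, 0 < r → 2 * r < R → R < R₀ →
          modulus μ Q
              (joiningCurves (closure (Metric.ball x₀ r)) (Metric.ball x₀ R)ᶜ Set.univ) ≤
            ENNReal.ofReal (C₁ * Real.log (R / r) ^ (1 - Q)) := by
  refine ⟨C₀ * 4 ^ Q * 2⁻¹ ^ (1 - Q), by positivity, ?_⟩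
  intro X _ _ _ _ μ _ x₀ R₀ _ hμ r R hr hrR hRR₀
  have hRr : 2 < R / r := (lt_div_iff₀ hr).2 hrR
  obtain ⟨N, hNle, hNlt⟩ := exists_nat_pow_near (by linarith : 1 ≤ R / r) one_lt_two
  have hN : 0 < N := by
    rcases Nat.eq_zero_or_pos N with rfl | h
    · norm_num at hNlt
      linarith
    · exact h
  have hNR : 2 ^ N * r ≤ R := (le_div_iff₀ hr).1 hNle
  have hlog : 0 < Real.log (R / r) := Real.log_pos (by linarith)
  have hlogN : 2⁻¹ * Real.log (R / r) ≤ N := by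
    have h₁ : Real.log (R / r) ≤ (N + 1 : ℕ) * Real.log 2 := by
      rw [← Real.log_pow]
      exact Real.log_le_log (by linarith) hNlt.le
    have h₂ : (1 : ℝ) ≤ N := Nat.one_le_cast.2 hN
    have h₃ : Real.log 2 ≤ 1 := by linarith [Real.log_two_lt_d9]
    push_cast at h₁
    nlinarith
  refine (iInf₂_le_of_le (dyadicDensity x₀ r N) (measurable_dyadicDensity x₀ r N)
    (iInf_le_of_le (fun γ hγ => one_le_lineIntegral_dyadicDensity hr hN hNR hγ)
      (lintegral_dyadicDensity_rpow_le (by linarith) hC₀ hμ hr hN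
        (hNR.trans_lt hRR₀)))).trans (ENNReal.ofReal_le_ofReal ?_)
  rw [mul_assoc _ (2⁻¹ ^ (1 - Q)), ← Real.mul_rpow (by norm_num) hlog.le]
  exact mul_le_mul_of_nonneg_left
    (Real.rpow_le_rpow_of_nonpos (by positivity) hlogN (by linarith)) (by positivity)
end
end

section
/- Let Q > 1 and let (X,d,μ) be a proper metric measure space which satisfies a convexity (quasiconvexity) condition and is Ahlfors Q-regular. Then (X,d,μ) is Q-Loewner if and only if it supports a Q-Poincaré inequality. -/
open MeasureTheory Metric Set ENNReal Filter

noncomputable section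

variable {X Y : Type*} [MetricSpace X] [MetricSpace Y]

/-- `g` is an upper gradient of `u`: for every nonconstant rectifiable curve `γ` defined on a
compact interval, `|u(endpoint) - u(startpoint)| ≤ ∫_γ g dl`. -/
def IsUpperGradient {X : Type*} [MetricSpace X] (g : X → ℝ≥0∞) (u : X → ℝ) : Prop :=
  ∀ (γ : Curve X) (a b : ℝ), a ≤ b → γ.carrier = Set.Icc a b → γ.Rectifiable →
    ¬(∀ s ∈ γ.carrier, γ.toFun s = γ.toFun a) →
    ENNReal.ofReal |u (γ.toFun b) - u (γ.toFun a)| ≤ γ.lineIntegral g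

/-- `(X,d,μ)` supports a `p`-Poincaré inequality: averaged oscillation of `u` on a ball is
controlled by `C r` times the `L^p`-average of any upper gradient on the dilated ball. -/
def SupportsPoincare {X : Type*} [MetricSpace X] [MeasurableSpace X]
    (p : ℝ) (μ : Measure X) : Prop :=
  ∃ τ C : ℝ, 0 < τ ∧ 0 < C ∧ ∀ (x : X) (r : ℝ), 0 < r →
    ∀ u : X → ℝ, Measurable u → ∀ g : X → ℝ≥0∞, Measurable g → IsUpperGradient g u →
      (∫⁻ y in Metric.ball x r, ENNReal.ofReal |u y - ⨍ z in Metric.ball x r, u z ∂μ| ∂μ) /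
          μ (Metric.ball x r) ≤
        ENNReal.ofReal (C * r) *
          ((∫⁻ y in Metric.ball x (τ * r), g y ^ p ∂μ) / μ (Metric.ball x (τ * r))) ^ (1 / p)

/-- A local `p`-Poincaré inequality: each point has a neighbourhood scale within which the
Poincaré inequality holds for balls. -/
def SupportsLocalPoincare {X : Type*} [MetricSpace X] [MeasurableSpace X]
    (p : ℝ) (μ : Measure X) : Prop :=
  ∃ τ C : ℝ, 0 < τ ∧ 0 < C ∧ ∀ x₀ : X, ∃ R : ℝ, 0 < R ∧
    ∀ (x : X) (r : ℝ), 0 < r → x ∈ Metric.ball x₀ R →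
      Metric.ball x (τ * r) ⊆ Metric.ball x₀ R →
      ∀ u : X → ℝ, Measurable u → ∀ g : X → ℝ≥0∞, Measurable g → IsUpperGradient g u →
        (∫⁻ y in Metric.ball x r, ENNReal.ofReal |u y - ⨍ z in Metric.ball x r, u z ∂μ| ∂μ) /
            μ (Metric.ball x r) ≤
          ENNReal.ofReal (C * r) *
            ((∫⁻ y in Metric.ball x (τ * r), g y ^ p ∂μ) / μ (Metric.ball x (τ * r))) ^ (1 / p)

/-- Ahlfors `Q`-regularity: balls of radius `r < diam X` have measure comparable to `r^Q`. -/
def AhlforsRegular {X : Type*} [MetricSpace X] [MeasurableSpace X]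
    (Q : ℝ) (μ : Measure X) : Prop :=
  ∃ C : ℝ, 1 ≤ C ∧ ∀ (x : X) (r : ℝ), 0 < r →
    ENNReal.ofReal r < EMetric.diam (Set.univ : Set X) →
      ENNReal.ofReal (r ^ Q) / ENNReal.ofReal C ≤ μ (Metric.ball x r) ∧
        μ (Metric.ball x r) ≤ ENNReal.ofReal (C * r ^ Q)

/-- Local Ahlfors `Q`-regularity: each point has a neighbourhood on which the two-sided
`r^Q` bound holds for balls contained in it. -/
def LocAhlforsRegular {X : Type*} [MetricSpace X] [MeasurableSpace X]
    (Q : ℝ) (μ : Measure X) : Prop :=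
  ∀ x₀ : X, ∃ R C : ℝ, 0 < R ∧ 1 ≤ C ∧
    ∀ x ∈ Metric.ball x₀ R, ∀ r : ℝ, 0 < r → Metric.ball x r ⊆ Metric.ball x₀ R →
      ENNReal.ofReal (r ^ Q) / ENNReal.ofReal C ≤ μ (Metric.ball x r) ∧
        μ (Metric.ball x r) ≤ ENNReal.ofReal (C * r ^ Q)

/-- A metric space is quasiconvex if any two points can be joined by a curve whose length is
at most a fixed multiple of their distance. -/
def IsQuasiconvexSpace (X : Type*) [MetricSpace X] : Prop :=
  ∃ C : ℝ, 1 ≤ C ∧ ∀ x y : X, ∃ (γ : Curve X) (a b : ℝ), a ≤ b ∧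
    γ.carrier = Set.Icc a b ∧ γ.toFun a = x ∧ γ.toFun b = y ∧
    γ.length ≤ ENNReal.ofReal (C * dist x y)

theorem Curve.lineIntegral_mono (γ : Curve X) {ρ σ : X → ℝ≥0∞}
    (h : ∀ s ∈ γ.carrier, ρ (γ.toFun s) ≤ σ (γ.toFun s)) :
    γ.lineIntegral ρ ≤ γ.lineIntegral σ := by
  unfold Curve.lineIntegral
  refine iSup_mono fun n => iSup_mono fun t => iSup_mono fun _ => iSup_mono fun _ => ?_
  refine Finset.sum_le_sum fun i _ => mul_le_mul_left ?_ _
  exact iInf₂_mono fun s hs => h s hs.1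

theorem Curve.le_lineIntegral (γ : Curve X) (ρ : X → ℝ≥0∞) (n : ℕ) (t : ℕ → ℝ)
    (h₁ : ∀ i, i < n → t i ≤ t (i + 1)) (h₂ : ∀ i, i ≤ n → t i ∈ γ.carrier) :
    ∑ i ∈ Finset.range n, (⨅ s ∈ γ.carrier ∩ Set.Icc (t i) (t (i + 1)), ρ (γ.toFun s)) *
        eVariationOn γ.toFun (γ.carrier ∩ Set.Icc (t i) (t (i + 1))) ≤ γ.lineIntegral ρ := by
  unfold Curve.lineIntegral
  exact le_iSup_of_le n (le_iSup_of_le t (le_iSup_of_le h₁ (le_iSup_of_le h₂ le_rfl)))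

/-- If `c ≠ 0, ∞` then the line integral is homogeneous in the density. -/
theorem Curve.lineIntegral_const_mul (γ : Curve X) (ρ : X → ℝ≥0∞) {c : ℝ≥0∞} (h0 : c ≠ 0)
    (hc : c ≠ ⊤) : γ.lineIntegral (fun x => c * ρ x) = c * γ.lineIntegral ρ := by
  unfold Curve.lineIntegral
  simp only [ENNReal.mul_iSup, Finset.mul_sum]
  refine iSup_congr fun n => iSup_congr fun t => iSup_congr fun _ => iSup_congr fun _ => ?_
  refine Finset.sum_congr rfl fun i _ => ?_
  simp only [← mul_assoc, ENNReal.mul_iInf_of_ne h0 hc]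

/-- A density controlling a function at a fixed small scale controls it along every curve. -/
theorem Curve.ofReal_abs_sub_le_lineIntegral (γ : Curve X) {ρ : X → ℝ≥0∞} {w : X → ℝ} {δ : ℝ}
    (hδ : 0 < δ)
    (hw : ∀ p q, dist p q ≤ δ →
      ENNReal.ofReal (w q - w p) ≤ edist p q * ⨅ z ∈ closedBall p δ, ρ z)
    {s t : ℝ} (hs : s ∈ γ.carrier) (ht : t ∈ γ.carrier) :
    ENNReal.ofReal |w (γ.toFun t) - w (γ.toFun s)| ≤ γ.lineIntegral ρ := by
  wlog hst : s ≤ t generalizing s t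
  · rw [abs_sub_comm]; exact this ht hs (le_of_not_ge hst)
  have hsub : Icc s t ⊆ γ.carrier := γ.ordConn.out hs ht
  have huc := isCompact_Icc.uniformContinuousOn_of_continuous (γ.cont.mono hsub)
  obtain ⟨η, hη, hηδ⟩ := Metric.uniformContinuousOn_iff.1 huc δ hδ
  obtain ⟨n, hn⟩ := exists_nat_gt ((t - s) / η)
  have hn0 : (0 : ℝ) < n := lt_of_le_of_lt (div_nonneg (by linarith) hη.le) hn
  set d : ℝ := (t - s) / n with hd
  have hd0 : 0 ≤ d := div_nonneg (by linarith) hn0.le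
  have hdη : d < η := by
    rw [hd, div_lt_iff₀ hn0]; rw [div_lt_iff₀ hη] at hn; linarith
  have hnd : n * d = t - s := by rw [hd]; field_simp
  set u : ℕ → ℝ := fun i => s + i * d with hu
  have hu_mono : ∀ i, u i ≤ u (i + 1) := fun i => by simp only [hu]; push_cast; linarith
  have hu_mem : ∀ i, i ≤ n → u i ∈ Icc s t := fun i hi => by
    have : (i : ℝ) ≤ n := by exact_mod_cast hi
    simp only [hu]
    constructor
    · nlinarith [mul_nonneg (Nat.cast_nonneg (α := ℝ) i) hd0]
    · nlinarith
  refine le_trans ?_ (γ.le_lineIntegral ρ n u (fun i _ => hu_mono i)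
    (fun i hi => hsub (hu_mem i hi)))
  have hstep : ∀ i ∈ Finset.range n, ENNReal.ofReal |w (γ.toFun (u (i + 1))) - w (γ.toFun (u i))| ≤
      (⨅ r ∈ γ.carrier ∩ Set.Icc (u i) (u (i + 1)), ρ (γ.toFun r)) *
        eVariationOn γ.toFun (γ.carrier ∩ Set.Icc (u i) (u (i + 1))) := by
    intro i hi
    have hi' : i < n := Finset.mem_range.1 hi
    have m1 := hu_mem i hi'.le
    have m2 := hu_mem (i + 1) hi'
    have hlen : u (i + 1) = u i + d := by simp only [hu]; push_cast; ring
    have hclose : ∀ a ∈ Icc (u i) (u (i + 1)), ∀ b ∈ Icc (u i) (u (i + 1)),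
        dist (γ.toFun a) (γ.toFun b) ≤ δ := by
      intro a ha b hb
      refine (hηδ a ⟨m1.1.trans ha.1, ha.2.trans m2.2⟩ b ⟨m1.1.trans hb.1, hb.2.trans m2.2⟩ ?_).le
      rw [Real.dist_eq, abs_lt]
      constructor <;> linarith [ha.1, ha.2, hb.1, hb.2]
    have key : ∀ a ∈ Icc (u i) (u (i + 1)), ∀ b ∈ Icc (u i) (u (i + 1)),
        ENNReal.ofReal (w (γ.toFun b) - w (γ.toFun a)) ≤
        (⨅ r ∈ γ.carrier ∩ Set.Icc (u i) (u (i + 1)), ρ (γ.toFun r)) *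
        eVariationOn γ.toFun (γ.carrier ∩ Set.Icc (u i) (u (i + 1))) := by
      intro a ha b hb
      have hca : a ∈ γ.carrier := hsub ⟨m1.1.trans ha.1, ha.2.trans m2.2⟩
      have hcb : b ∈ γ.carrier := hsub ⟨m1.1.trans hb.1, hb.2.trans m2.2⟩
      refine (hw _ _ (hclose a ha b hb)).trans ?_
      rw [mul_comm]
      refine mul_le_mul' ?_ (eVariationOn.edist_le _ ⟨hca, ha⟩ ⟨hcb, hb⟩)
      refine le_iInf₂ fun r hr => iInf₂_le _ ?_
      rw [mem_closedBall]
      exact hclose r hr.2 a ha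
    have l := left_mem_Icc.2 (hu_mono i)
    have r := right_mem_Icc.2 (hu_mono i)
    rcases abs_cases (w (γ.toFun (u (i + 1))) - w (γ.toFun (u i))) with h | h
    · rw [h.1]; exact key _ l _ r
    · rw [h.1, neg_sub]; exact key _ r _ l
  refine le_trans ?_ (Finset.sum_le_sum hstep)
  rw [← ENNReal.ofReal_sum_of_nonneg fun _ _ => abs_nonneg _]
  refine ENNReal.ofReal_le_ofReal ?_
  refine le_trans (le_of_eq ?_) (Finset.abs_sum_le_sum_abs _ _)
  rw [Finset.sum_range_sub (fun i => w (γ.toFun (u i)))]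
  have : u n = t := by simp only [hu]; linarith
  rw [this]; simp [hu]

/-- Discrete density at scale `δ`: the infimum of `ρ` over the `δ`-ball, truncated at `δ⁻¹`. -/
def chainWeight (ρ : X → ℝ≥0∞) (δ : ℝ) (p : X) : ℝ≥0∞ :=
  (⨅ z ∈ closedBall p δ, ρ z) ⊓ ENNReal.ofReal δ⁻¹

/-- The least cost of a `δ`-chain from `E` to `x`. -/
def chainCost (ρ : X → ℝ≥0∞) (δ : ℝ) (E : Set X) (x : X) : ℝ≥0∞ :=
  ⨅ (c : ℕ → X) (N : ℕ) (_ : c 0 ∈ E) (_ : ∀ i < N, dist (c i) (c (i + 1)) ≤ δ) (_ : c N = x),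
    ∑ i ∈ Finset.range N, edist (c i) (c (i + 1)) * chainWeight ρ δ (c i)

/-- The chain cost truncated at level `T`, as a real function. -/
def chainDist (ρ : X → ℝ≥0∞) (δ : ℝ) (E : Set X) (T : ℝ) (x : X) : ℝ :=
  (min (chainCost ρ δ E x) (ENNReal.ofReal T)).toReal

theorem chainCost_le (ρ : X → ℝ≥0∞) {δ : ℝ} {E : Set X} {c : ℕ → X} {N : ℕ} (h0 : c 0 ∈ E)
    (h1 : ∀ i < N, dist (c i) (c (i + 1)) ≤ δ) :
    chainCost ρ δ E (c N) ≤
      ∑ i ∈ Finset.range N, edist (c i) (c (i + 1)) * chainWeight ρ δ (c i) := by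
  unfold chainCost
  exact iInf_le_of_le c <| iInf_le_of_le N <| iInf_le_of_le h0 <| iInf_le_of_le h1 <|
    iInf_le_of_le rfl le_rfl

theorem chainCost_le_add (ρ : X → ℝ≥0∞) {δ : ℝ} (E : Set X) {p q : X} (h : dist p q ≤ δ) :
    chainCost ρ δ E q ≤ chainCost ρ δ E p + edist p q * chainWeight ρ δ p := by
  conv_rhs => rw [chainCost]
  simp only [ENNReal.iInf_add]
  refine le_iInf fun c => le_iInf fun N => le_iInf fun h0 => le_iInf fun h1 => le_iInf fun h2 => ?_
  set c' : ℕ → X := fun i => if i ≤ N then c i else q with hc'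
  have e1 : ∀ i, i ≤ N → c' i = c i := fun i hi => if_pos hi
  have e2 : c' (N + 1) = q := if_neg (by omega)
  rw [← e2]
  refine (chainCost_le ρ (c := c') (N := N + 1) ?_ ?_).trans ?_
  · rw [e1 0 (Nat.zero_le _)]; exact h0
  · intro i hi
    rcases Nat.lt_succ_iff_lt_or_eq.1 hi with hi | rfl
    · rw [e1 i hi.le, e1 (i + 1) hi]; exact h1 i hi
    · rw [e1 i le_rfl, e2, h2]; exact h
  · rw [Finset.sum_range_succ, e2, e1 N le_rfl, h2]
    refine add_le_add_left (le_of_eq ?_) _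
    refine Finset.sum_congr rfl fun i hi => ?_
    have hi := Finset.mem_range.1 hi
    rw [e1 i hi.le, e1 (i + 1) hi]

theorem chainCost_eq_zero (ρ : X → ℝ≥0∞) (δ : ℝ) {E : Set X} {x : X} (hx : x ∈ E) :
    chainCost ρ δ E x = 0 := by
  refine le_antisymm ?_ zero_le
  simpa using chainCost_le ρ (δ := δ) (c := fun _ => x) (N := 0) hx (by simp)

theorem chainDist_eq_zero (ρ : X → ℝ≥0∞) (δ : ℝ) {E : Set X} (T : ℝ) {x : X} (hx : x ∈ E) :
    chainDist ρ δ E T x = 0 := by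
  simp [chainDist, chainCost_eq_zero ρ δ hx]

theorem chainDist_nonneg (ρ : X → ℝ≥0∞) (δ : ℝ) (E : Set X) (T : ℝ) (x : X) :
    0 ≤ chainDist ρ δ E T x := ENNReal.toReal_nonneg

theorem chainCost_le_of_chainDist_le {ρ : X → ℝ≥0∞} {δ : ℝ} {E : Set X} {T A : ℝ} {x : X}
    (hA : A < T) (h : chainDist ρ δ E T x ≤ A) : chainCost ρ δ E x ≤ ENNReal.ofReal A := by
  have hA0 : 0 ≤ A := (chainDist_nonneg ρ δ E T x).trans h
  have hfin : min (chainCost ρ δ E x) (ENNReal.ofReal T) ≠ ⊤ :=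
    ne_top_of_le_ne_top ENNReal.ofReal_ne_top (min_le_right _ _)
  have h1 := (ENNReal.le_ofReal_iff_toReal_le hfin hA0).2 h
  rcases min_le_iff.1 h1 with h2 | h2
  · exact h2
  · exact absurd h2 (not_le.2 ((ENNReal.ofReal_lt_ofReal_iff (hA0.trans_lt hA)).2 hA))

theorem ofReal_chainDist_sub_le (ρ : X → ℝ≥0∞) {δ : ℝ} (E : Set X) (T : ℝ) {p q : X}
    (h : dist p q ≤ δ) :
    ENNReal.ofReal (chainDist ρ δ E T q - chainDist ρ δ E T p) ≤
      edist p q * chainWeight ρ δ p := by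
  have hfin : ∀ x, min (chainCost ρ δ E x) (ENNReal.ofReal T) ≠ ⊤ := fun x =>
    ne_top_of_le_ne_top ENNReal.ofReal_ne_top (min_le_right _ _)
  rw [ENNReal.ofReal_sub _ (chainDist_nonneg _ _ _ _ _), chainDist, chainDist,
    ENNReal.ofReal_toReal (hfin _), ENNReal.ofReal_toReal (hfin _), tsub_le_iff_right]
  rcases le_total (chainCost ρ δ E p) (ENNReal.ofReal T) with h1 | h1
  · rw [min_eq_left h1, add_comm]
    exact (min_le_left _ _).trans (chainCost_le_add ρ E h)
  · rw [min_eq_right h1]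
    exact (min_le_right _ _).trans le_add_self

theorem ofReal_abs_chainDist_sub_le_lineIntegral (ρ : X → ℝ≥0∞) {δ : ℝ} (hδ : 0 < δ) (E : Set X)
    (T : ℝ) (γ : Curve X) {s t : ℝ} (hs : s ∈ γ.carrier) (ht : t ∈ γ.carrier) :
    ENNReal.ofReal |chainDist ρ δ E T (γ.toFun t) - chainDist ρ δ E T (γ.toFun s)| ≤
      γ.lineIntegral ρ :=
  γ.ofReal_abs_sub_le_lineIntegral hδ (fun _ _ h =>
    (ofReal_chainDist_sub_le ρ E T h).trans (mul_le_mul_right inf_le_left _)) hs ht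

theorem continuous_chainDist (ρ : X → ℝ≥0∞) {δ : ℝ} (hδ : 0 < δ) (E : Set X) (T : ℝ) :
    Continuous (chainDist ρ δ E T) := by
  have key : ∀ p q, dist p q ≤ δ →
      chainDist ρ δ E T q - chainDist ρ δ E T p ≤ dist p q * δ⁻¹ := by
    intro p q h
    have h1 := (ofReal_chainDist_sub_le ρ E T h).trans (mul_le_mul_right inf_le_right _)
    rw [edist_dist, ← ENNReal.ofReal_mul dist_nonneg] at h1
    exact (ENNReal.ofReal_le_ofReal_iff (by positivity)).1 h1
  rw [Metric.continuous_iff]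
  intro b ε hε
  refine ⟨min δ (ε * δ), lt_min hδ (mul_pos hε hδ), fun a ha => ?_⟩
  have ha1 := ha.trans_le (min_le_left _ _)
  have ha2 : dist a b * δ⁻¹ < ε := by
    rw [← div_eq_mul_inv, div_lt_iff₀ hδ]; exact ha.trans_le (min_le_right _ _)
  rw [Real.dist_eq, abs_lt]
  have h1 := key a b ha1.le
  have h2 := key b a (by rw [dist_comm]; exact ha1.le)
  rw [dist_comm] at h2
  constructor <;> linarith

theorem Finset.sum_range_sum_Ico_of_monotone {M : Type*} [AddCommMonoid M] (f : ℕ → M) (k : ℕ → ℕ)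
    (m : ℕ) (hk : ∀ i < m, k i ≤ k (i + 1)) :
    k 0 ≤ k m ∧ ∑ i ∈ Finset.range m, ∑ j ∈ Finset.Ico (k i) (k (i + 1)), f j =
      ∑ j ∈ Finset.Ico (k 0) (k m), f j := by
  induction m with
  | zero => simp
  | succ m ih =>
    obtain ⟨h1, h2⟩ := ih fun i hi => hk i (hi.trans (Nat.lt_succ_self m))
    have h3 := hk m (Nat.lt_succ_self m)
    exact ⟨h1.trans h3, by rw [Finset.sum_range_succ, h2, Finset.sum_Ico_consecutive _ h1 h3]⟩

theorem eVariationOn_comp_le_sum_edist (c : ℕ → X) {ι : ℝ → ℕ} (hι : Monotone ι) {S : Set ℝ}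
    {a b : ℝ} (hS : S ⊆ Icc a b) :
    eVariationOn (fun t => c (ι t)) S ≤
      ∑ j ∈ Finset.Ico (ι a) (ι b), edist (c j) (c (j + 1)) := by
  refine iSup_le ?_
  rintro ⟨m, u, hu, huS⟩
  have hmono : Monotone fun i => ι (u i) := hι.comp hu
  calc ∑ i ∈ Finset.range m, edist (c (ι (u (i + 1)))) (c (ι (u i)))
      ≤ ∑ i ∈ Finset.range m, ∑ j ∈ Finset.Ico (ι (u i)) (ι (u (i + 1))),
          edist (c j) (c (j + 1)) := by
        refine Finset.sum_le_sum fun i _ => ?_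
        rw [edist_comm]
        exact edist_le_Ico_sum_edist c (hmono (Nat.le_succ i))
    _ = ∑ j ∈ Finset.Ico (ι (u 0)) (ι (u m)), edist (c j) (c (j + 1)) :=
        (Finset.sum_range_sum_Ico_of_monotone _ (fun i => ι (u i)) m
          fun i _ => hmono (Nat.le_succ i)).2
    _ ≤ _ := Finset.sum_le_sum_of_subset
        (Finset.Ico_subset_Ico (hι (hS (huS 0)).1) (hι (hS (huS m)).2))

/-- A finite chain can be parametrized by its length, as a step function. -/
theorem exists_chain_parametrization (c : ℕ → X) (N : ℕ) {δ L : ℝ}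
    (hδ : ∀ i < N, dist (c i) (c (i + 1)) ≤ δ) (hδ0 : 0 ≤ δ)
    (hL : ∑ i ∈ Finset.range N, dist (c i) (c (i + 1)) ≤ L) :
    ∃ ι : ℝ → ℕ, Monotone ι ∧ (∀ t, ι t ≤ N) ∧ ι L = N ∧ c (ι 0) = c 0 ∧
      (∀ s t, 0 ≤ s → s ≤ t → dist (c (ι s)) (c (ι t)) ≤ t - s + δ) ∧
      ∀ a b, 0 ≤ a → a ≤ b → ∀ k, ι a ≤ k → k < ι b → ∃ s ∈ Icc a b, c k = c (ι s) := by
  classical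
  set l : ℕ → ℝ := fun i => ∑ j ∈ Finset.range i, dist (c j) (c (j + 1)) with hl
  have hl0 : l 0 = 0 := by simp [hl]
  have hls : ∀ i, l (i + 1) = l i + dist (c i) (c (i + 1)) := fun i => Finset.sum_range_succ _ _
  have hlm : Monotone l := monotone_nat_of_le_succ fun i => by
    rw [hls]; linarith [dist_nonneg (x := c i) (y := c (i + 1))]
  have hdist : ∀ i j, i ≤ j → dist (c i) (c j) ≤ l j - l i := by
    intro i j hij
    have := dist_le_Ico_sum_dist c hij
    rwa [Finset.sum_Ico_eq_sub _ hij] at this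
  set ι : ℝ → ℕ := fun t => Nat.findGreatest (fun i => l i ≤ t) N with hι
  have hle : ∀ t, ι t ≤ N := fun t => Nat.findGreatest_le N
  have hspec : ∀ t, 0 ≤ t → l (ι t) ≤ t := fun t ht =>
    Nat.findGreatest_spec (P := fun i => l i ≤ t) (Nat.zero_le N) (by rw [hl0]; exact ht)
  have hge : ∀ t k, k ≤ N → l k ≤ t → k ≤ ι t := fun t k hk h =>
    Nat.le_findGreatest (P := fun i => l i ≤ t) hk h
  have hmono : Monotone ι := fun s t hst =>
    Nat.findGreatest_mono (fun i (hi : l i ≤ s) => hi.trans hst) le_rfl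
  refine ⟨ι, hmono, hle, le_antisymm (hle L) (hge L N le_rfl hL), ?_, ?_, ?_⟩
  · have h1 := hspec 0 le_rfl
    have h2 := hdist 0 (ι 0) (Nat.zero_le _)
    exact (dist_le_zero.1 (by linarith)).symm
  · intro s t hs hst
    have h1 := hdist _ _ (hmono hst)
    have h2 := hspec t (hs.trans hst)
    rcases (hle s).lt_or_eq with h | h
    · have h3 : s < l (ι s + 1) := by
        by_contra hcon
        have := hge s (ι s + 1) h (not_lt.1 hcon)
        omega
      have h4 := hδ _ h
      rw [hls] at h3
      linarith
    · have h5 : ι t = ι s := le_antisymm (by rw [h]; exact hle t) (hmono hst)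
      rw [h5, dist_self]; linarith
  · intro a b ha hab k hak hkb
    have hkN : k ≤ N := hkb.le.trans (hle b)
    rcases le_total a (l k) with h | h
    · refine ⟨l k, ⟨h, (hlm hkb.le).trans (hspec b (ha.trans hab))⟩, ?_⟩
      have h1 := hge (l k) k hkN le_rfl
      have h2 := hspec (l k) (ha.trans h)
      have h3 := hdist _ _ h1
      exact dist_le_zero.1 (by linarith)
    · exact ⟨a, ⟨le_rfl, hab⟩, by rw [le_antisymm (hge a k hkN h) hak]⟩

/-- If for a lower semicontinuous density bounded below there are arbitrarily fine chains from
`E` to `F` of cost less than `A`, then some curve from `E` to `F` has line integral at most `A`. -/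
theorem exists_curve_of_chainCost_lt [ProperSpace X] {ρ : X → ℝ≥0∞} (hρ : LowerSemicontinuous ρ)
    {ε : ℝ} (hε : 0 < ε) (hρε : ∀ x, ENNReal.ofReal ε ≤ ρ x) {E F : Set X} (hE : IsCompact E)
    (hF : IsClosed F) {A : ℝ} (hA : 0 ≤ A)
    (h : ∀ n : ℕ, ∃ z ∈ F, chainCost ρ (1 / ((n : ℝ) + 1)) E z < ENNReal.ofReal A) :
    ∃ (γ : Curve X) (L : ℝ), 0 ≤ L ∧ γ.carrier = Icc 0 L ∧ γ.toFun 0 ∈ E ∧ γ.toFun L ∈ F ∧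
      γ.Rectifiable ∧ γ.lineIntegral ρ ≤ ENNReal.ofReal A := by
  wlog hε1 : ε ≤ 1 generalizing ε
  · exact this one_pos
      (fun x => (ENNReal.ofReal_le_ofReal (le_of_not_ge hε1)).trans (hρε x)) le_rfl
  set δ : ℕ → ℝ := fun n => 1 / ((n : ℝ) + 1) with hδdef
  have hδpos : ∀ n, 0 < δ n := fun n => Nat.one_div_pos_of_nat
  have hδinv : ∀ n, (δ n)⁻¹ = (n : ℝ) + 1 := fun n => by simp [hδdef]
  have h' : ∀ n : ℕ, ∃ (c : ℕ → X) (N : ℕ), c 0 ∈ E ∧ (∀ i < N, dist (c i) (c (i + 1)) ≤ δ n) ∧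
      c N ∈ F ∧ ∑ i ∈ Finset.range N, edist (c i) (c (i + 1)) * chainWeight ρ (δ n) (c i) ≤
        ENNReal.ofReal A := by
    intro n
    obtain ⟨z, hz, hlt⟩ := h n
    unfold chainCost at hlt
    simp only [iInf_lt_iff] at hlt
    obtain ⟨c, N, h0, h1, h2, h3⟩ := hlt
    exact ⟨c, N, h0, h1, h2 ▸ hz, h3.le⟩
  choose c N hc0 hcδ hcN hcost using h'
  have hW : ∀ n x, ENNReal.ofReal ε ≤ chainWeight ρ (δ n) x := by
    intro n x
    refine le_inf (le_iInf₂ fun z _ => hρε z) (ENNReal.ofReal_le_ofReal ?_)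
    rw [hδinv]; linarith [Nat.cast_nonneg (α := ℝ) n]
  set L : ℝ := A / ε with hLdef
  have hL0 : 0 ≤ L := div_nonneg hA hε.le
  have hlen : ∀ n, ∑ i ∈ Finset.range (N n), dist (c n i) (c n (i + 1)) ≤ L := by
    intro n
    rw [hLdef, le_div_iff₀ hε, ← ENNReal.ofReal_le_ofReal_iff hA]
    refine le_trans ?_ (hcost n)
    rw [ENNReal.ofReal_mul (Finset.sum_nonneg fun _ _ => dist_nonneg),
      ENNReal.ofReal_sum_of_nonneg fun _ _ => dist_nonneg, Finset.sum_mul]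
    refine Finset.sum_le_sum fun i _ => ?_
    rw [← edist_dist]
    exact mul_le_mul_right (hW n _) _
  choose ι hιm hιN hιL hι0 hιd hιk using fun n =>
    exists_chain_parametrization (c n) (N n) (hcδ n) (hδpos n).le (hlen n)
  have hK : ∀ n t, c n (ι n t) ∈ cthickening L E := by
    intro n t
    refine mem_cthickening_of_dist_le _ (c n 0) L E (hc0 n) ?_
    rw [dist_comm]
    refine (dist_le_range_sum_dist (c n) _).trans (le_trans ?_ (hlen n))
    exact Finset.sum_le_sum_of_subset_of_nonneg
      (Finset.range_subset_range.2 (hιN n t)) fun _ _ _ => dist_nonneg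
  set U : Ultrafilter ℕ := hyperfilter ℕ with hU
  have hUδ : Tendsto δ U (nhds 0) :=
    tendsto_one_div_add_atTop_nhds_zero_nat.mono_left Nat.hyperfilter_le_atTop
  have hlim : ∀ t, ∃ y, Tendsto (fun n => c n (ι n t)) U (nhds y) := by
    intro t
    obtain ⟨y, -, hy⟩ := hE.cthickening.ultrafilter_le_nhds' (U.map fun n => c n (ι n t))
      (Ultrafilter.mem_map.2 (Filter.univ_mem' fun n => hK n t))
    exact ⟨y, hy⟩
  choose g hg using hlim
  have hgL : ∀ s t, 0 ≤ s → s ≤ t → dist (g s) (g t) ≤ t - s := by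
    intro s t hs hst
    have h1 : Tendsto (fun n => t - s + δ n) U (nhds (t - s + 0)) := hUδ.const_add _
    rw [add_zero] at h1
    exact le_of_tendsto_of_tendsto ((hg s).dist (hg t)) h1
      (Eventually.of_forall fun n => hιd n s t hs hst)
  have hLip : LipschitzOnWith 1 g (Icc 0 L) := by
    refine LipschitzOnWith.of_dist_le_mul fun s hs t ht => ?_
    rw [NNReal.coe_one, one_mul, Real.dist_eq]
    rcases le_total s t with hst | hst
    · rw [abs_sub_comm, abs_of_nonneg (by linarith)]; exact hgL s t hs.1 hst
    · rw [dist_comm, abs_of_nonneg (by linarith)]; exact hgL t s ht.1 hst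
  refine ⟨⟨Icc 0 L, ⟨0, le_rfl, hL0⟩, ordConnected_Icc, g, hLip.continuousOn⟩, L, hL0, rfl, ?_, ?_,
    ?_, ?_⟩
  · exact hE.isClosed.mem_of_tendsto (hg 0) (Eventually.of_forall fun n => by
      rw [hι0]; exact hc0 n)
  · exact hF.mem_of_tendsto (hg L) (Eventually.of_forall fun n => by rw [hιL]; exact hcN n)
  · have h1 := hLip.comp_eVariationOn_le (g := id) (s := Icc 0 L) (mapsTo_id _)
    have h2 := (monotone_id (α := ℝ)).monotoneOn (Icc 0 L) |>.eVariationOn_eq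
      (left_mem_Icc.2 hL0) (right_mem_Icc.2 hL0)
    rw [inter_self] at h2
    refine lt_of_le_of_lt (h1.trans (mul_le_mul_right h2.le _)) ?_
    rw [ENNReal.coe_one, one_mul]
    exact ENNReal.ofReal_lt_top
  · unfold Curve.lineIntegral
    refine iSup_le fun m => iSup_le fun t => iSup_le fun htm => iSup_le fun htc => ?_
    change ∀ i, i ≤ m → t i ∈ Icc 0 L at htc
    set B : ℕ → ℕ → ℝ≥0∞ := fun i n => ∑ k ∈ Finset.Ico (ι n (t i)) (ι n (t (i + 1))),
      edist (c n k) (c n (k + 1)) * chainWeight ρ (δ n) (c n k) with hB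
    have hBlim : ∀ i, ∃ β, Tendsto (B i) U (nhds β) := fun i => by
      obtain ⟨y, -, hy⟩ := isCompact_univ.ultrafilter_le_nhds' (U.map (B i)) Filter.univ_mem
      exact ⟨y, hy⟩
    choose β hβ using hBlim
    have hsum : ∑ i ∈ Finset.range m, β i ≤ ENNReal.ofReal A := by
      refine le_of_tendsto (tendsto_finsetSum (Finset.range m) fun i _ => hβ i)
        (Eventually.of_forall fun n => le_trans ?_ (hcost n))
      rw [(Finset.sum_range_sum_Ico_of_monotone _ (fun i => ι n (t i)) m
        fun i hi => hιm n (htm i hi)).2, Finset.range_eq_Ico]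
      exact Finset.sum_le_sum_of_subset (Finset.Ico_subset_Ico (Nat.zero_le _) (hιN n _))
    refine le_trans (Finset.sum_le_sum fun i hi => ?_) hsum
    have hi : i < m := Finset.mem_range.1 hi
    have hti := htc i hi.le
    have hti' := htc (i + 1) hi
    have hPsub : Icc (t i) (t (i + 1)) ⊆ Icc 0 L := Icc_subset_Icc hti.1 hti'.2
    change (⨅ s ∈ Icc 0 L ∩ Icc (t i) (t (i + 1)), ρ (g s)) *
      eVariationOn g (Icc 0 L ∩ Icc (t i) (t (i + 1))) ≤ β i
    rw [inter_eq_right.2 hPsub]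
    refine ENNReal.mul_le_of_forall_lt fun a ha b hb => ?_
    have hvar : ∀ᶠ n in (U : Filter ℕ),
        b < eVariationOn (fun s => c n (ι n s)) (Icc (t i) (t (i + 1))) :=
      eVariationOn.lowerSemicontinuous_aux (F := fun n s => c n (ι n s)) (fun s _ => hg s) hb
    have hcap : ∀ᶠ n in (U : Filter ℕ), a ≤ ENNReal.ofReal (δ n)⁻¹ := by
      have ha' : a ≠ ⊤ := ne_top_of_lt ha
      obtain ⟨M, hM⟩ := exists_nat_gt a.toReal
      refine Nat.hyperfilter_le_atTop (eventually_atTop.2 ⟨M, fun n hn => ?_⟩)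
      rw [hδinv, ← ENNReal.ofReal_toReal ha']
      refine ENNReal.ofReal_le_ofReal ?_
      have : (M : ℝ) ≤ n := by exact_mod_cast hn
      linarith
    have hwt : ∀ᶠ n in (U : Filter ℕ), ∀ k ∈ Finset.Ico (ι n (t i)) (ι n (t (i + 1))),
        a ≤ chainWeight ρ (δ n) (c n k) := by
      by_contra hcon
      rw [← Ultrafilter.eventually_not] at hcon
      have hex : ∀ᶠ n in (U : Filter ℕ), ∃ sz : ℝ × X, sz.1 ∈ Icc (t i) (t (i + 1)) ∧
          dist sz.2 (c n (ι n sz.1)) ≤ δ n ∧ ρ sz.2 < a := by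
        filter_upwards [hcon, hcap] with n hn hcapn
        push Not at hn
        obtain ⟨k, hk, hlt⟩ := hn
        rw [Finset.mem_Ico] at hk
        obtain ⟨s, hs, hks⟩ := hιk n _ _ hti.1 (htm i hi) k hk.1 hk.2
        have hlt' : ⨅ z ∈ closedBall (c n k) (δ n), ρ z < a := by
          rcases inf_lt_iff.1 hlt with h1 | h1
          · exact h1
          · exact absurd hcapn (not_le.2 h1)
        simp only [iInf_lt_iff] at hlt'
        obtain ⟨z, hz, hza⟩ := hlt'
        exact ⟨(s, z), hs, by rw [← hks]; exact hz, hza⟩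
      have : Nonempty (ℝ × X) := ⟨(0, g 0)⟩
      obtain ⟨f, hf⟩ := hex.choice
      obtain ⟨s, hs, hfs⟩ := isCompact_Icc.ultrafilter_le_nhds' (s := Icc (t i) (t (i + 1)))
        (U.map fun n => (f n).1) (Ultrafilter.mem_map.2 (hf.mono fun n hn => hn.1))
      have hfs : Tendsto (fun n => (f n).1) U (nhds s) := hfs
      have hz : Tendsto (fun n => (f n).2) U (nhds (g s)) := by
        rw [tendsto_iff_dist_tendsto_zero]
        have hbd : Tendsto (fun n => δ n + (|(f n).1 - s| + δ n) + dist (c n (ι n s)) (g s)) U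
            (nhds 0) := by
          have h1 : Tendsto (fun n => |(f n).1 - s|) U (nhds 0) := by
            simpa [Real.dist_eq] using tendsto_iff_dist_tendsto_zero.1 hfs
          simpa using (hUδ.add (h1.add hUδ)).add (tendsto_iff_dist_tendsto_zero.1 (hg s))
        refine squeeze_zero' (Eventually.of_forall fun _ => dist_nonneg) ?_ hbd
        filter_upwards [hf] with n hn
        have h1 : dist (c n (ι n (f n).1)) (c n (ι n s)) ≤ |(f n).1 - s| + δ n := by
          rcases le_total (f n).1 s with h | h
          · rw [abs_sub_comm, abs_of_nonneg (by linarith)]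
            exact hιd n _ _ (hti.1.trans hn.1.1) h
          · rw [dist_comm, abs_of_nonneg (by linarith)]
            exact hιd n _ _ (hti.1.trans hs.1) h
        have h2 := dist_triangle4 (f n).2 (c n (ι n (f n).1)) (c n (ι n s)) (g s)
        linarith [hn.2.1]
      have hlsc := hz.eventually (hρ (g s) a (ha.trans_le (iInf₂_le s hs)))
      obtain ⟨n, hn1, hn2⟩ := (hlsc.and hf).exists
      exact lt_asymm hn1 hn2.2.2
    refine ge_of_tendsto (hβ i) ?_
    filter_upwards [hvar, hwt] with n hn1 hn2
    calc a * b ≤ a * ∑ k ∈ Finset.Ico (ι n (t i)) (ι n (t (i + 1))),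
          edist (c n k) (c n (k + 1)) :=
          mul_le_mul_right (hn1.le.trans
            (eVariationOn_comp_le_sum_edist (c n) (hιm n) subset_rfl)) _
      _ ≤ B i n := by
          rw [Finset.mul_sum]
          refine Finset.sum_le_sum fun k hk => ?_
          rw [mul_comm]
          exact mul_le_mul_right (hn2 k hk) _

section Regular

variable [MeasurableSpace X] {μ : Measure X} {Q : ℝ}

theorem AhlforsRegular.exists_measure_ball_le [Nontrivial X] [ProperSpace X]
    [IsLocallyFiniteMeasure μ] (hQ : 0 ≤ Q) (h : AhlforsRegular Q μ) :
    ∃ C : ℝ, 0 < C ∧ ∀ (x : X) (r : ℝ), 0 < r → μ (ball x r) ≤ ENNReal.ofReal (C * r ^ Q) := by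
  obtain ⟨C, hC1, hC⟩ := h
  have hC0 : 0 < C := one_pos.trans_le hC1
  by_cases hD : ediam (univ : Set X) = ⊤
  · refine ⟨C, hC0, fun x r hr => (hC x r hr ?_).2⟩
    exact lt_of_lt_of_eq ENNReal.ofReal_lt_top hD.symm
  set D := (ediam (univ : Set X)).toReal with hDdef
  have hDe : ENNReal.ofReal D = ediam (univ : Set X) := ENNReal.ofReal_toReal hD
  have hDpos : 0 < D := ENNReal.toReal_pos
    (ediam_pos_iff.2 (nontrivial_univ_iff.2 inferInstance)).ne' hD
  have hcomp : IsCompact (univ : Set X) :=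
    Metric.isCompact_of_isClosed_isBounded isClosed_univ (isBounded_iff_ediam_ne_top.2 hD)
  have hfin : μ univ ≠ ⊤ := hcomp.measure_lt_top.ne
  refine ⟨max C ((μ univ).toReal / D ^ Q), lt_max_of_lt_left hC0, fun x r hr => ?_⟩
  rcases lt_or_ge r D with hrD | hrD
  · refine (hC x r hr ?_).2.trans (ENNReal.ofReal_le_ofReal
      (mul_le_mul_of_nonneg_right (le_max_left _ _) (by positivity)))
    exact lt_of_lt_of_eq ((ENNReal.ofReal_lt_ofReal_iff hDpos).2 hrD) hDe
  · refine (measure_mono (subset_univ _)).trans ?_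
    refine (ENNReal.ofReal_toReal hfin).symm.le.trans ?_
    refine ENNReal.ofReal_le_ofReal (le_trans ?_
      (mul_le_mul_of_nonneg_right (le_max_right _ _) (by positivity)))
    have h1 : D ^ Q ≤ r ^ Q := Real.rpow_le_rpow hDpos.le hrD hQ
    rw [div_mul_eq_mul_div, le_div_iff₀ (by positivity)]
    exact mul_le_mul_of_nonneg_left h1 ENNReal.toReal_nonneg

theorem AhlforsRegular.exists_le_measure_ball (h : AhlforsRegular Q μ) {K : ℝ} (hK : 1 ≤ K) :
    ∃ c : ℝ, 0 < c ∧ ∀ (x p q : X) (r : ℝ), 0 < r → r ≤ K * dist p q →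
      ENNReal.ofReal (c * r ^ Q) ≤ μ (ball x r) := by
  obtain ⟨C, hC1, hC⟩ := h
  have hC0 : 0 < C := one_pos.trans_le hC1
  have hK0 : 0 < K := one_pos.trans_le hK
  refine ⟨(2 * K)⁻¹ ^ Q / C, by positivity, fun x p q r hr hrK => ?_⟩
  have hr' : 0 < (2 * K)⁻¹ * r := by positivity
  have hlt : (2 * K)⁻¹ * r < dist p q := by
    rw [inv_mul_lt_iff₀ (by positivity)]
    nlinarith
  have h1 : ENNReal.ofReal ((2 * K)⁻¹ * r) < ediam (univ : Set X) := by
    refine lt_of_lt_of_le ?_ (edist_le_ediam_of_mem (mem_univ p) (mem_univ q))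
    rw [edist_dist]
    exact (ENNReal.ofReal_lt_ofReal_iff (hr'.trans hlt)).2 hlt
  have h2 := (hC x _ hr' h1).1
  rw [← ENNReal.ofReal_div_of_pos hC0, Real.mul_rpow (by positivity) hr.le] at h2
  refine le_trans (le_of_eq ?_) (h2.trans (measure_mono (ball_subset_ball ?_)))
  · congr 1; ring
  · have : (2 * K)⁻¹ ≤ 1 := inv_le_one_of_one_le₀ (by linarith)
    nlinarith

theorem AhlforsRegular.measure_ball_pos [Nontrivial X] (h : AhlforsRegular Q μ) (x : X) {r : ℝ}
    (hr : 0 < r) : 0 < μ (ball x r) := by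
  obtain ⟨p, q, hpq⟩ := exists_pair_ne X
  obtain ⟨c, hc, hcb⟩ := h.exists_le_measure_ball le_rfl
  have hd : 0 < min r (dist p q) := lt_min hr (dist_pos.2 hpq)
  refine lt_of_lt_of_le ?_ (measure_mono (ball_subset_ball (min_le_left r (dist p q))))
  refine lt_of_lt_of_le ?_ (hcb x p q _ hd (by rw [one_mul]; exact min_le_right _ _))
  exact ENNReal.ofReal_pos.2 (by positivity)

theorem AhlforsRegular.exists_doubling [Nontrivial X] [ProperSpace X]
    [IsLocallyFiniteMeasure μ] (hQ : 0 ≤ Q) (h : AhlforsRegular Q μ) {τ : ℝ} (hτ : 0 < τ) :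
    ∃ D : ℝ, 1 ≤ D ∧ ∀ (x : X) (r : ℝ), 0 < r →
      μ (ball x (τ * r)) ≤ ENNReal.ofReal D * μ (ball x r) := by
  obtain ⟨C, hC, hCb⟩ := h.exists_measure_ball_le hQ
  obtain ⟨c, hc, hcb⟩ := h.exists_le_measure_ball le_rfl
  refine ⟨max 1 (C * τ ^ Q / c), le_max_left _ _, fun x r hr => ?_⟩
  by_cases hex : ∃ p q : X, r ≤ dist p q
  · obtain ⟨p, q, hpq⟩ := hex
    calc μ (ball x (τ * r)) ≤ ENNReal.ofReal (C * (τ * r) ^ Q) := hCb x _ (by positivity)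
      _ = ENNReal.ofReal (C * τ ^ Q / c) * ENNReal.ofReal (c * r ^ Q) := by
          rw [← ENNReal.ofReal_mul (by positivity), Real.mul_rpow hτ.le hr.le]
          congr 1; field_simp
      _ ≤ _ := mul_le_mul' (ENNReal.ofReal_le_ofReal (le_max_right _ _))
          (hcb x p q r hr (by rwa [one_mul]))
  · push Not at hex
    have : ball x r = univ := eq_univ_of_forall fun y => hex y x
    rw [this]
    calc μ (ball x (τ * r)) ≤ 1 * μ univ := by rw [one_mul]; exact measure_mono (subset_univ _)
      _ ≤ _ := mul_le_mul_left (ENNReal.one_le_ofReal.2 (le_max_left _ _)) _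

end Regular

section Covering

variable [MeasurableSpace X] [BorelSpace X]

/-- The Vitali covering lemma, together with the disjointness estimate for integrals. -/
theorem exists_disjoint_ball_cover [TopologicalSpace.SeparableSpace X] (μ : Measure X)
    (S : Set X) (rad : X → ℝ) (R : ℝ) (h : ∀ z ∈ S, 0 < rad z ∧ rad z ≤ R) :
    ∃ u ⊆ S, u.Countable ∧ S ⊆ (⋃ z ∈ u, closedBall z (5 * rad z)) ∧
      ∀ (f : X → ℝ≥0∞) (D : Set X), (∀ z ∈ u, ball z (rad z) ⊆ D) →
        ∑' z : u, ∫⁻ y in ball (z : X) (rad z), f y ∂μ ≤ ∫⁻ y in D, f y ∂μ := by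
  obtain ⟨u, huS, hdisj, hcov⟩ := Vitali.exists_disjoint_subfamily_covering_enlargement_closedBall
    S (fun z => z) rad R (fun z hz => (h z hz).2) 5 (by norm_num)
  have hdisj' : u.PairwiseDisjoint fun z => ball z (rad z) :=
    hdisj.mono fun z => ball_subset_closedBall
  have hcount : u.Countable := hdisj'.countable_of_isOpen (fun z _ => isOpen_ball)
    fun z hz => nonempty_ball.2 (h z (huS hz)).1
  refine ⟨u, huS, hcount, fun z hz => ?_, fun f D hD => ?_⟩
  · obtain ⟨b, hb, hzb⟩ := hcov z hz
    exact mem_biUnion hb (hzb (mem_closedBall_self (h z hz).1.le))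
  · rw [← lintegral_biUnion hcount (fun _ _ => measurableSet_ball) hdisj']
    exact lintegral_mono_set (iUnion₂_subset hD)

/-- A Borel density is dominated by a lower semicontinuous density bounded away from zero, with
almost the same energy on a given ball. -/
theorem exists_lowerSemicontinuous_majorant [ProperSpace X] (μ : Measure X)
    [IsLocallyFiniteMeasure μ] {Q : ℝ} (hQ : 0 < Q) {g : X → ℝ≥0∞} (hg : Measurable g) (x₀ : X)
    (R : ℝ) {J : ℝ≥0∞} (hJ : ∫⁻ y in ball x₀ R, g y ^ Q ∂μ < J) :
    ∃ ρ : X → ℝ≥0∞, LowerSemicontinuous ρ ∧ (∀ x, g x ≤ ρ x) ∧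
      (∃ ε : ℝ, 0 < ε ∧ ∀ x, ENNReal.ofReal ε ≤ ρ x) ∧ ∫⁻ y in ball x₀ R, ρ y ^ Q ∂μ ≤ J := by
  set I := ∫⁻ y in ball x₀ R, g y ^ Q ∂μ with hI
  have hB : μ (ball x₀ R) < ⊤ := measure_ball_lt_top
  have : IsFiniteMeasure (μ.restrict (ball x₀ R)) :=
    ⟨by rw [Measure.restrict_apply_univ]; exact hB⟩
  set m := μ (ball x₀ R) + 1 with hm
  have hm0 : m ≠ 0 := by simp [hm]
  have hmt : m ≠ ⊤ := ENNReal.add_ne_top.2 ⟨hB.ne, ENNReal.one_ne_top⟩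
  set e : ℝ≥0∞ := min 1 ((J - I) / m) with he
  have he0 : 0 < e := lt_min one_pos (ENNReal.div_pos (tsub_pos_of_lt hJ).ne' hmt)
  have het : e ≠ ⊤ := ne_top_of_le_ne_top ENNReal.one_ne_top (min_le_left _ _)
  have hem : e * m ≤ J - I :=
    (mul_le_mul_left (min_le_right _ _) _).trans (ENNReal.div_mul_cancel hm0 hmt).le
  obtain ⟨G, hfG, hGl, hGi⟩ := exists_le_lowerSemicontinuous_lintegral_ge
    (μ.restrict (ball x₀ R)) (fun x => g x ^ Q + e) ((hg.pow_const Q).add_const e) he0.ne'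
  have hQ' : 0 < 1 / Q := one_div_pos.2 hQ
  refine ⟨fun x => G x ^ (1 / Q),
    (ENNReal.continuous_rpow_const).comp_lowerSemicontinuous hGl
      (ENNReal.monotone_rpow_of_nonneg hQ'.le), fun x => ?_,
    ⟨(e ^ (1 / Q)).toReal, ENNReal.toReal_pos ?_ ?_, fun x => ?_⟩, ?_⟩
  · rw [one_div, ENNReal.le_rpow_inv_iff hQ]
    exact le_self_add.trans (hfG x)
  · simp [ENNReal.rpow_eq_zero_iff, he0.ne', het]
  · exact ENNReal.rpow_ne_top_of_nonneg hQ'.le het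
  · rw [ENNReal.ofReal_toReal (ENNReal.rpow_ne_top_of_nonneg hQ'.le het)]
    exact ENNReal.rpow_le_rpow (le_add_self.trans (hfG x)) hQ'.le
  · calc ∫⁻ y in ball x₀ R, (G y ^ (1 / Q)) ^ Q ∂μ = ∫⁻ y in ball x₀ R, G y ∂μ := by
          refine lintegral_congr fun y => ?_
          rw [← ENNReal.rpow_mul, one_div_mul_cancel hQ.ne', ENNReal.rpow_one]
      _ ≤ _ := hGi
      _ = I + e * m := by
          rw [lintegral_add_right _ measurable_const, lintegral_const,
            Measure.restrict_apply_univ, hm]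
          ring
      _ ≤ I + (J - I) := add_le_add_right hem _
      _ = J := add_tsub_cancel_of_le hJ.le

end Covering

theorem log_clamp_sub_le {s R a b : ℝ} (hs : 0 < s) (hsR : s ≤ R) (hab : a ≤ b) :
    Real.log (max s (min b R)) - Real.log (max s (min a R)) ≤ (b - a) / max s (min a R) := by
  set α := max s (min a R) with hα
  set β := max s (min b R) with hβ
  have hα0 : 0 < α := lt_max_of_lt_left hs
  have hβ0 : 0 < β := lt_max_of_lt_left hs
  have h1 : β - α ≤ b - a := by
    rcases max_cases s (min a R) with h | h <;> rcases max_cases s (min b R) with h' | h' <;>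
    rcases min_cases a R with k | k <;> rcases min_cases b R with k' | k' <;> linarith
  rw [← Real.log_div hβ0.ne' hα0.ne']
  refine (Real.log_le_sub_one_of_pos (by positivity)).trans ?_
  rw [div_sub_one hα0.ne']
  exact div_le_div_of_nonneg_right h1 hα0.le

/-- The logarithmic density of an annulus. -/
def annulusDensity (x : X) (s R : ℝ) (z : X) : ℝ≥0∞ :=
  {z : X | s / 2 ≤ dist z x ∧ dist z x ≤ 2 * R}.indicator
    (fun z => ENNReal.ofReal (2 / (Real.log (R / s) * dist z x))) z

theorem Curve.one_le_lineIntegral_annulusDensity (γ : Curve X) {x : X} {s R : ℝ} (hs : 0 < s)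
    (hsR : s < R) {a b : ℝ} (ha : a ∈ γ.carrier) (hb : b ∈ γ.carrier)
    (has : dist (γ.toFun a) x ≤ s) (hbR : R ≤ dist (γ.toFun b) x) :
    1 ≤ γ.lineIntegral (annulusDensity x s R) := by
  have hR : 0 < R := hs.trans hsR
  have hL : 0 < Real.log (R / s) := Real.log_pos ((one_lt_div hs).2 hsR)
  have key := γ.ofReal_abs_sub_le_lineIntegral (ρ := annulusDensity x s R)
    (w := fun z => Real.log (max s (min (dist z x) R)) / Real.log (R / s)) (δ := s / 4)
    (by positivity) ?_ ha hb
  · refine le_trans (le_of_eq ?_) key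
    have e1 : max s (min (dist (γ.toFun b) x) R) = R := by
      rw [min_eq_right hbR, max_eq_right hsR.le]
    have e2 : max s (min (dist (γ.toFun a) x) R) = s :=
      max_eq_left ((min_le_left _ _).trans has)
    simp only [e1, e2]
    rw [← sub_div, ← Real.log_div hR.ne' hs.ne', div_self hL.ne', abs_one, ENNReal.ofReal_one]
  · intro p q hpq
    have hq : dist q x ≤ dist p x + s / 4 := by
      linarith [dist_triangle q p x, dist_comm p q]
    by_cases hle : Real.log (max s (min (dist q x) R)) ≤ Real.log (max s (min (dist p x) R))
    · rw [ENNReal.ofReal_of_nonpos]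
      · exact zero_le
      · rw [← sub_div]
        exact div_nonpos_of_nonpos_of_nonneg (by linarith) hL.le
    push Not at hle
    have hlt : max s (min (dist p x) R) < max s (min (dist q x) R) :=
      (Real.log_lt_log_iff (lt_max_of_lt_left hs) (lt_max_of_lt_left hs)).1 hle
    have hqs : s < dist q x := by
      by_contra! hcon
      rw [max_eq_left ((min_le_left _ _).trans hcon)] at hlt
      exact absurd hlt (not_lt.2 (le_max_left _ _))
    have hpR : dist p x < R := by
      by_contra! hcon
      rw [min_eq_right hcon] at hlt
      exact absurd hlt (not_lt.2 (max_le_max le_rfl (min_le_right _ _)))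
    have hpq' : dist p x ≤ dist q x := by
      by_contra! hcon
      exact absurd hlt (not_lt.2 (max_le_max le_rfl (min_le_min hcon.le le_rfl)))
    rw [min_eq_left hpR.le] at *
    set α := max s (dist p x) with hα
    have hα0 : 0 < α := lt_max_of_lt_left hs
    have h1 := log_clamp_sub_le hs hsR.le hpq'
    rw [min_eq_left hpR.le, ← hα] at h1
    have h2 : dist q x - dist p x ≤ dist p q := by
      linarith [dist_triangle q p x, dist_comm p q]
    have h3 : ENNReal.ofReal (1 / (Real.log (R / s) * α)) ≤
        ⨅ z ∈ closedBall p (s / 4), annulusDensity x s R z := by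
      refine le_iInf₂ fun z hz => ?_
      rw [mem_closedBall] at hz
      have hz1 : dist z x ≤ dist p x + s / 4 := by linarith [dist_triangle z p x]
      have hz2 : dist p x ≤ dist z x + s / 4 := by
        linarith [dist_triangle p z x, dist_comm p z]
      rw [annulusDensity, indicator_of_mem (by constructor <;> linarith)]
      refine ENNReal.ofReal_le_ofReal ?_
      have hz0 : 0 < dist z x := by linarith
      have : dist z x ≤ 2 * α := by
        linarith [le_max_left s (dist p x), le_max_right s (dist p x)]
      rw [div_le_div_iff₀ (by positivity) (by positivity)]
      nlinarith
    refine le_trans ?_ (mul_le_mul_right h3 _)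
    rw [edist_dist, ← ENNReal.ofReal_mul dist_nonneg]
    refine ENNReal.ofReal_le_ofReal ?_
    rw [← sub_div, div_le_iff₀ hL]
    refine h1.trans ((div_le_div_of_nonneg_right h2 hα0.le).trans (le_of_eq ?_))
    field_simp

section Loewner

variable [MeasurableSpace X] [BorelSpace X] {μ : Measure X} {Q : ℝ}

theorem measurable_annulusDensity (x : X) (s R : ℝ) : Measurable (annulusDensity x s R) := by
  refine Measurable.indicator ?_ ?_
  · exact ENNReal.measurable_ofReal.comp
      (measurable_const.div (measurable_const.mul (continuous_id.dist continuous_const).measurable))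
  · exact ((isClosed_le continuous_const (continuous_id.dist continuous_const)).inter
      (isClosed_le (continuous_id.dist continuous_const) continuous_const)).measurableSet

theorem lintegral_annulusDensity_le {C : ℝ} (hQ : 0 < Q)
    (hμ : ∀ (x : X) (r : ℝ), 0 < r → μ (ball x r) ≤ ENNReal.ofReal (C * r ^ Q)) (x : X) {s : ℝ}
    (hs : 0 < s) {N : ℕ} (hN : 1 ≤ N) :
    ∫⁻ z, annulusDensity x s (2 ^ N * s) z ^ Q ∂μ ≤
      ENNReal.ofReal ((N + 3) * (C * (4 / (N * Real.log 2)) ^ Q)) := by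
  have hN0 : (0 : ℝ) < N := by exact_mod_cast hN
  have hl2 : 0 < Real.log 2 := Real.log_pos one_lt_two
  have hlog : Real.log (2 ^ N * s / s) = N * Real.log 2 := by
    rw [mul_div_cancel_right₀ _ hs.ne', Real.log_pow]
  set c : ℕ → ℝ := fun k => 4 / (N * Real.log 2 * (2 ^ k * s)) with hc
  have hc0 : ∀ k, 0 < c k := fun k => by positivity
  have hpt : ∀ z, annulusDensity x s (2 ^ N * s) z ^ Q ≤ ∑ k ∈ Finset.range (N + 3),
      (ball x (2 ^ k * s)).indicator (fun _ => ENNReal.ofReal (c k ^ Q)) z := by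
    intro z
    by_cases hz : s / 2 ≤ dist z x ∧ dist z x ≤ 2 * (2 ^ N * s)
    · have hz0 : 0 < dist z x := by linarith [hz.1]
      have hlast : dist z x < 2 ^ (N + 2) * s := by
        have : 0 < 2 ^ N * s := by positivity
        rw [pow_add]; nlinarith [hz.2]
      have hex : ∃ k : ℕ, dist z x < 2 ^ k * s := ⟨_, hlast⟩
      classical
      set k := Nat.find hex with hk
      have hk1 : dist z x < 2 ^ k * s := Nat.find_spec hex
      have hk2 : k ≤ N + 2 := Nat.find_min' hex hlast
      have hk3 : 2 ^ k * s ≤ 2 * dist z x := by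
        rcases Nat.eq_zero_or_pos k with h0 | h0
        · rw [h0]; linarith [hz.1]
        · have := Nat.find_min hex (m := k - 1) (by omega)
          push Not at this
          calc (2 : ℝ) ^ k * s = 2 * (2 ^ (k - 1) * s) := by
                conv_lhs => rw [show k = k - 1 + 1 by omega, pow_succ]
                ring
            _ ≤ _ := by linarith
      refine le_trans ?_ (Finset.single_le_sum (f := fun k =>
        (ball x (2 ^ k * s)).indicator (fun _ => ENNReal.ofReal (c k ^ Q)) z)
        (fun _ _ => zero_le) (Finset.mem_range.2 (show k < N + 3 by omega)))
      rw [annulusDensity, indicator_of_mem (show z ∈ {z | s / 2 ≤ dist z x ∧ dist z x ≤ 2 * (2 ^ N * s)} from hz),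
        indicator_of_mem (mem_ball.2 hk1), hlog,
        ENNReal.ofReal_rpow_of_nonneg (by positivity) hQ.le]
      refine ENNReal.ofReal_le_ofReal (Real.rpow_le_rpow (by positivity) ?_ hQ.le)
      rw [hc, div_le_div_iff₀ (by positivity) (by positivity)]
      have : 0 < N * Real.log 2 := by positivity
      nlinarith
    · rw [annulusDensity, indicator_of_notMem
          (show z ∉ {z | s / 2 ≤ dist z x ∧ dist z x ≤ 2 * (2 ^ N * s)} from hz),
        ENNReal.zero_rpow_of_pos hQ]
      exact zero_le
  calc ∫⁻ z, annulusDensity x s (2 ^ N * s) z ^ Q ∂μ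
      ≤ ∫⁻ z, ∑ k ∈ Finset.range (N + 3),
        (ball x (2 ^ k * s)).indicator (fun _ => ENNReal.ofReal (c k ^ Q)) z ∂μ :=
        lintegral_mono hpt
    _ = ∑ k ∈ Finset.range (N + 3), ENNReal.ofReal (c k ^ Q) * μ (ball x (2 ^ k * s)) := by
        rw [lintegral_finsetSum _ fun k _ => measurable_const.indicator measurableSet_ball]
        refine Finset.sum_congr rfl fun k _ => ?_
        rw [lintegral_indicator_const measurableSet_ball]
    _ ≤ ∑ k ∈ Finset.range (N + 3), ENNReal.ofReal (C * (4 / (N * Real.log 2)) ^ Q) := by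
        refine Finset.sum_le_sum fun k _ => ?_
        refine (mul_le_mul_right (hμ x _ (by positivity)) _).trans (le_of_eq ?_)
        rw [← ENNReal.ofReal_mul (by have := hc0 k; positivity)]
        congr 1
        rw [mul_left_comm, ← Real.mul_rpow (hc0 k).le (by positivity)]
        congr 2
        rw [hc]; field_simp
    _ = _ := by
        rw [Finset.sum_const, Finset.card_range, nsmul_eq_mul, ENNReal.ofReal_mul (by positivity : (0 : ℝ) ≤ N + 3),
          ← ENNReal.ofReal_natCast]
        push_cast; rfl

theorem exists_density_leaving {C : ℝ} (hQ : 1 < Q) (hC : 0 ≤ C)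
    (hμ : ∀ (x : X) (r : ℝ), 0 < r → μ (ball x r) ≤ ENNReal.ofReal (C * r ^ Q)) {η : ℝ}
    (hη : 0 < η) :
    ∃ Λ : ℝ, 1 < Λ ∧ ∀ (x : X) (s : ℝ), 0 < s → ∃ σ : X → ℝ≥0∞, Measurable σ ∧
      (∀ (γ : Curve X), ∀ a ∈ γ.carrier, ∀ b ∈ γ.carrier, dist (γ.toFun a) x ≤ s →
        Λ * s ≤ dist (γ.toFun b) x → 1 ≤ γ.lineIntegral σ) ∧
      ∫⁻ z, σ z ^ Q ∂μ ≤ ENNReal.ofReal η := by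
  have hl2 : 0 < Real.log 2 := Real.log_pos one_lt_two
  have hlim : Tendsto (fun N : ℕ => 4 * (C * (4 / Real.log 2) ^ Q) * (N : ℝ) ^ (-(Q - 1)))
      atTop (nhds (4 * (C * (4 / Real.log 2) ^ Q) * 0)) :=
    ((tendsto_rpow_neg_atTop (by linarith)).comp tendsto_natCast_atTop_atTop).const_mul _
  rw [mul_zero] at hlim
  obtain ⟨N, hN, hN1⟩ := ((hlim.eventually (gt_mem_nhds hη)).and (eventually_ge_atTop 1)).exists
  have hN0 : (1 : ℝ) ≤ N := by exact_mod_cast hN1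
  refine ⟨2 ^ N, one_lt_pow₀ _root_.one_lt_two (Nat.one_le_iff_ne_zero.1 hN1), fun x s hs =>
    ⟨annulusDensity x s (2 ^ N * s), measurable_annulusDensity _ _ _,
      fun γ a ha b hb has hbR => γ.one_le_lineIntegral_annulusDensity hs
        (lt_mul_of_one_lt_left hs (one_lt_pow₀ _root_.one_lt_two (Nat.one_le_iff_ne_zero.1 hN1))) ha hb has hbR,
      (lintegral_annulusDensity_le (by linarith) hμ x hs hN1).trans
        (ENNReal.ofReal_le_ofReal (le_trans ?_ hN.le))⟩⟩
  have e : (4 / (N * Real.log 2)) ^ Q = (4 / Real.log 2) ^ Q * ((N : ℝ) ^ (-(Q - 1)) * (N : ℝ)⁻¹) := by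
    rw [show 4 / (N * Real.log 2) = (4 / Real.log 2) * (N : ℝ)⁻¹ by field_simp,
      Real.mul_rpow (by positivity) (by positivity)]
    congr 1
    rw [← Real.rpow_neg_one (N : ℝ), ← Real.rpow_mul (by positivity), ← Real.rpow_add (by positivity)]
    congr 1; ring
  rw [e]
  have h4 : ((N : ℝ) + 3) * (N : ℝ)⁻¹ ≤ 4 := by
    rw [← div_eq_mul_inv, div_le_iff₀ (by linarith)]; linarith
  calc ((N : ℝ) + 3) * (C * ((4 / Real.log 2) ^ Q * ((N : ℝ) ^ (-(Q - 1)) * (N : ℝ)⁻¹)))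
      = (((N : ℝ) + 3) * (N : ℝ)⁻¹) * (C * (4 / Real.log 2) ^ Q * (N : ℝ) ^ (-(Q - 1))) := by ring
    _ ≤ 4 * (C * (4 / Real.log 2) ^ Q * (N : ℝ) ^ (-(Q - 1))) :=
        mul_le_mul_of_nonneg_right h4 (by positivity)
    _ = _ := by ring

/-- In a Loewner space with upper mass bounds, the energy of a density which is large along all
curves joining two large continua inside a bigger ball is bounded below. -/
theorem IsLoewner.exists_energy_le (h : IsLoewner Q X μ) {C : ℝ} (hQ : 1 < Q) (hC : 0 ≤ C)
    (hμ : ∀ (x : X) (r : ℝ), 0 < r → μ (ball x r) ≤ ENNReal.ofReal (C * r ^ Q)) {κ : ℝ}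
    (hκ : 1 ≤ κ) :
    ∃ Λ c : ℝ, 1 < Λ ∧ 0 < c ∧ ∀ (x : X) (s : ℝ), 0 < s → ∀ E F : Set X, IsContinuum E →
      IsContinuum F → Disjoint E F → E ⊆ closedBall x s → F ⊆ closedBall x s →
      (∃ p ∈ E, ∃ q ∈ E, s / κ ≤ dist p q) → (∃ p ∈ F, ∃ q ∈ F, s / κ ≤ dist p q) →
      ∀ g : X → ℝ≥0∞, Measurable g → ∀ lam : ℝ, 0 < lam →
        (∀ γ ∈ joiningCurves E F (ball x (Λ * s)), ENNReal.ofReal lam ≤ γ.lineIntegral g) →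
        ENNReal.ofReal (c * lam ^ Q) ≤ ∫⁻ y in ball x (Λ * s), g y ^ Q ∂μ := by
  obtain ⟨φ, -, hφ, hL⟩ := h
  have hκ0 : 0 < κ := one_pos.trans_le hκ
  have hQ0 : 0 < Q := one_pos.trans hQ
  obtain ⟨hm0, hmt⟩ := hφ (2 * κ) (by positivity)
  set m := φ (2 * κ) with hm
  have hmr : 0 < m.toReal := ENNReal.toReal_pos hm0.ne' hmt.ne
  obtain ⟨Λ, hΛ, hσ⟩ := exists_density_leaving hQ hC hμ (half_pos hmr)
  refine ⟨Λ, m.toReal / 2, hΛ, half_pos hmr, ?_⟩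
  rintro x s hs E F hE hF hEF hEs hFs ⟨p, hp, q, hq, hpq⟩ ⟨p', hp', q', hq', hpq'⟩ g hg lam hlam
    hadm
  have hsκ : 0 < s / κ := by positivity
  have hEn : E.Nontrivial := ⟨p, hp, q, hq, dist_pos.1 (hsκ.trans_le hpq)⟩
  have hFn : F.Nontrivial := ⟨p', hp', q', hq', dist_pos.1 (hsκ.trans_le hpq')⟩
  have hdiam : ∀ {A : Set X} {a b : X}, a ∈ A → b ∈ A → s / κ ≤ dist a b →
      ENNReal.ofReal (s / κ) ≤ ediam A := fun ha hb hab =>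
    (ENNReal.ofReal_le_ofReal hab).trans
      ((edist_dist _ _).symm.le.trans (edist_le_ediam_of_mem ha hb))
  have hdist : setEDist E F ≤ ENNReal.ofReal (2 * κ) * min (ediam E) (ediam F) := by
    calc setEDist E F ≤ edist p p' := (iInf₂_le p hp).trans (infEDist_le_edist_of_mem hp')
      _ ≤ ENNReal.ofReal (2 * s) := by
        rw [edist_dist]
        refine ENNReal.ofReal_le_ofReal ?_
        have h1 := mem_closedBall.1 (hEs hp)
        have h2 := mem_closedBall.1 (hFs hp')
        linarith [dist_triangle_right p p' x]
      _ = ENNReal.ofReal (2 * κ) * ENNReal.ofReal (s / κ) := by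
        rw [← ENNReal.ofReal_mul (by positivity)]
        congr 1; field_simp
      _ ≤ _ := mul_le_mul_right (le_min (hdiam hp hq hpq) (hdiam hp' hq' hpq')) _
  have hmod := hL E F hE hEn hF hFn hEF (2 * κ) (by positivity) hdist
  obtain ⟨σ, hσm, hσ1, hσ2⟩ := hσ x s hs
  set B := ball x (Λ * s) with hB
  set g₁ : X → ℝ≥0∞ := B.indicator fun z => ENNReal.ofReal lam⁻¹ * g z with hg₁
  have hg₁m : Measurable g₁ := (hg.const_mul _).indicator measurableSet_ball
  have hle : m ≤ ∫⁻ z, (max (g₁ z) (σ z)) ^ Q ∂μ := by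
    refine hmod.trans (iInf_le_of_le (fun z => max (g₁ z) (σ z))
      (iInf_le_of_le (hg₁m.max hσm) (iInf_le_of_le ?_ le_rfl)))
    rintro γ ⟨-, ⟨a, ha, haE⟩, hbF⟩
    by_cases hin : γ.toFun '' γ.carrier ⊆ B
    · have h1 := hadm γ ⟨hin, ⟨a, ha, haE⟩, hbF⟩
      have hl0 : ENNReal.ofReal lam⁻¹ ≠ 0 := (ENNReal.ofReal_pos.2 (by positivity)).ne'
      calc (1 : ℝ≥0∞) = ENNReal.ofReal lam⁻¹ * ENNReal.ofReal lam := by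
            rw [← ENNReal.ofReal_mul (by positivity), inv_mul_cancel₀ hlam.ne', ENNReal.ofReal_one]
        _ ≤ ENNReal.ofReal lam⁻¹ * γ.lineIntegral g := mul_le_mul_right h1 _
        _ = γ.lineIntegral fun z => ENNReal.ofReal lam⁻¹ * g z :=
            (γ.lineIntegral_const_mul g hl0 ENNReal.ofReal_ne_top).symm
        _ ≤ _ := γ.lineIntegral_mono fun r hr => by
            refine le_trans (le_of_eq ?_) (le_max_left _ _)
            rw [hg₁, indicator_of_mem (hin (mem_image_of_mem _ hr))]
    · obtain ⟨_, ⟨b, hb, rfl⟩, hbB⟩ := not_subset.1 hin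
      refine (hσ1 γ a ha b hb (mem_closedBall.1 (hEs haE)) (not_lt.1 hbB)).trans
        (γ.lineIntegral_mono fun _ _ => le_max_right _ _)
  have hsplit : ∫⁻ z, (max (g₁ z) (σ z)) ^ Q ∂μ ≤
      ENNReal.ofReal (lam⁻¹ ^ Q) * (∫⁻ y in B, g y ^ Q ∂μ) + ENNReal.ofReal (m.toReal / 2) := by
    calc ∫⁻ z, (max (g₁ z) (σ z)) ^ Q ∂μ ≤ ∫⁻ z, (g₁ z ^ Q + σ z ^ Q) ∂μ := by
          refine lintegral_mono fun z => ?_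
          rcases max_choice (g₁ z) (σ z) with h | h <;> simp only [h]
          exacts [le_self_add, le_add_self]
      _ = ∫⁻ z, g₁ z ^ Q ∂μ + ∫⁻ z, σ z ^ Q ∂μ := lintegral_add_left (hg₁m.pow_const Q) _
      _ ≤ _ := by
          refine add_le_add (le_of_eq ?_) hσ2
          rw [← lintegral_const_mul _ (hg.pow_const Q), ← lintegral_indicator measurableSet_ball]
          refine lintegral_congr fun z => ?_
          by_cases hz : z ∈ B
          · rw [hg₁, indicator_of_mem hz, indicator_of_mem hz, ENNReal.mul_rpow_of_nonneg _ _ hQ0.le,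
              ENNReal.ofReal_rpow_of_nonneg (by positivity) hQ0.le]
          · rw [hg₁, indicator_of_notMem hz, indicator_of_notMem hz, ENNReal.zero_rpow_of_pos hQ0]
  have hfin := hle.trans hsplit
  have hmm : m = ENNReal.ofReal (m.toReal / 2) + ENNReal.ofReal (m.toReal / 2) := by
    rw [← ENNReal.ofReal_add (by positivity) (by positivity), add_halves,
      ENNReal.ofReal_toReal hmt.ne]
  rw [hmm, ENNReal.toReal_add ENNReal.ofReal_ne_top ENNReal.ofReal_ne_top,
    ENNReal.toReal_ofReal (by positivity), add_halves] at hfin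
  have h2 := ENNReal.le_of_add_le_add_right ENNReal.ofReal_ne_top hfin
  calc ENNReal.ofReal (m.toReal / 2 * lam ^ Q)
      = ENNReal.ofReal (lam ^ Q) * ENNReal.ofReal (m.toReal / 2) := by
        rw [← ENNReal.ofReal_mul (by positivity), mul_comm]
    _ ≤ ENNReal.ofReal (lam ^ Q) * (ENNReal.ofReal (lam⁻¹ ^ Q) * ∫⁻ y in B, g y ^ Q ∂μ) :=
        mul_le_mul_right h2 _
    _ = _ := by
        rw [← mul_assoc, ← ENNReal.ofReal_mul (by positivity),
          ← Real.mul_rpow hlam.le (by positivity), mul_inv_cancel₀ hlam.ne', Real.one_rpow,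
          ENNReal.ofReal_one, one_mul]

end Loewner

theorem exists_crossing_Icc {f : ℝ → ℝ} {a b α β : ℝ} (hab : a ≤ b) (hf : ContinuousOn f (Icc a b))
    (ha : f a ≤ α) (hαβ : α ≤ β) (hb : β ≤ f b) :
    ∃ s t, s ≤ t ∧ Icc s t ⊆ Icc a b ∧ f s = α ∧ f t = β ∧ ∀ r ∈ Icc s t, f r ∈ Icc α β := by
  have hA : IsCompact (Icc a b ∩ f ⁻¹' Ici β) :=
    isCompact_Icc.of_isClosed_subset (hf.preimage_isClosed_of_isClosed isClosed_Icc isClosed_Ici)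
      inter_subset_left
  obtain ⟨t, ⟨htI, htβ⟩, htmin⟩ := hA.exists_isLeast ⟨b, ⟨hab, le_rfl⟩, hb⟩
  have hlt : ∀ r ∈ Icc a b, r < t → f r < β := fun r hr hrt => by
    by_contra! hcon
    exact absurd (htmin ⟨hr, hcon⟩) (not_le.2 hrt)
  have hfat : ContinuousOn f (Icc a t) := hf.mono (Icc_subset_Icc_right htI.2)
  have hft : f t = β := by
    obtain ⟨r, hr, hrβ⟩ := intermediate_value_Icc htI.1 hfat ⟨ha.trans hαβ, htβ⟩
    rcases hr.2.lt_or_eq with h | h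
    · exact absurd hrβ (hlt r ⟨hr.1, hr.2.trans htI.2⟩ h).ne
    · rw [← h, hrβ]
  have hB : IsCompact (Icc a t ∩ f ⁻¹' Iic α) :=
    isCompact_Icc.of_isClosed_subset (hfat.preimage_isClosed_of_isClosed isClosed_Icc isClosed_Iic)
      inter_subset_left
  obtain ⟨s, ⟨hsI, hsα⟩, hsmax⟩ := hB.exists_isGreatest ⟨a, ⟨le_rfl, htI.1⟩, ha⟩
  have hgt : ∀ r ∈ Icc a t, s < r → α < f r := fun r hr hsr => by
    by_contra! hcon
    exact absurd (hsmax ⟨hr, hcon⟩) (not_le.2 hsr)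
  have hfs : f s = α := by
    obtain ⟨r, hr, hrα⟩ := intermediate_value_Icc hsI.2 (hfat.mono (Icc_subset_Icc_left hsI.1))
      ⟨hsα, hft.symm ▸ hαβ⟩
    rcases hr.1.lt_or_eq with h | h
    · exact absurd hrα (hgt r ⟨hsI.1.trans hr.1, hr.2⟩ h).ne'
    · rw [h, hrα]
  refine ⟨s, t, hsI.2, Icc_subset_Icc hsI.1 htI.2, hfs, hft, fun r hr => ⟨?_, ?_⟩⟩
  · rcases hr.1.lt_or_eq with h | h
    · exact (hgt r ⟨hsI.1.trans hr.1, hr.2⟩ h).le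
    · rw [← h, hfs]
  · rcases hr.2.lt_or_eq with h | h
    · exact (hlt r ⟨hsI.1.trans hr.1, hr.2.trans htI.2⟩ h).le
    · rw [h, hft]

theorem IsQuasiconvexSpace.exists_continuum (h : IsQuasiconvexSpace X) (x y : X) {α β : ℝ}
    (hα : 0 ≤ α) (hαβ : α ≤ β) (hβ : β ≤ dist y x) :
    ∃ E : Set X, IsContinuum E ∧ (∀ z ∈ E, α ≤ dist z x ∧ dist z x ≤ β) ∧
      ∃ p ∈ E, ∃ q ∈ E, β - α ≤ dist p q := by
  obtain ⟨_, _, hγ⟩ := h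
  obtain ⟨γ, a, b, hab, hc, rfl, rfl, -⟩ := hγ x y
  have hγ := γ.cont
  rw [hc] at hγ
  obtain ⟨s, t, hst, hsub, hs, ht, hI⟩ := exists_crossing_Icc hab
    (f := fun r => dist (γ.toFun r) (γ.toFun a)) (continuous_dist.comp_continuousOn (hγ.prodMk continuousOn_const))
    (by simpa using hα) hαβ hβ
  have hcont := hγ.mono hsub
  refine ⟨γ.toFun '' Icc s t, ⟨isCompact_Icc.image_of_continuousOn hcont,
    (isConnected_Icc hst).image _ hcont⟩, ?_, γ.toFun s, mem_image_of_mem _ (left_mem_Icc.2 hst),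
    γ.toFun t, mem_image_of_mem _ (right_mem_Icc.2 hst), ?_⟩
  · rintro _ ⟨r, hr, rfl⟩
    exact hI r hr
  · rw [← hs, ← ht, dist_comm (γ.toFun s) (γ.toFun t)]
    linarith [dist_triangle (γ.toFun t) (γ.toFun s) (γ.toFun a)]

theorem Curve.exists_continuum (γ : Curve X) {s t : ℝ} (hs : s ∈ γ.carrier) (ht : t ∈ γ.carrier) :
    ∃ G ⊆ γ.toFun '' γ.carrier, IsContinuum G ∧ γ.toFun s ∈ G ∧ γ.toFun t ∈ G := by
  have hsub : uIcc s t ⊆ γ.carrier := γ.ordConn.uIcc_subset hs ht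
  have hcont := γ.cont.mono hsub
  exact ⟨γ.toFun '' uIcc s t, image_mono hsub, ⟨isCompact_uIcc.image_of_continuousOn hcont,
    isConnected_Icc inf_le_sup |>.image _ hcont⟩, mem_image_of_mem _ left_mem_uIcc,
    mem_image_of_mem _ right_mem_uIcc⟩

section Pointwise

variable [MeasurableSpace X] [BorelSpace X] {μ : Measure X} {Q : ℝ}

theorem IsLoewner.exists_lineIntegral_lt (h : IsLoewner Q X μ) {C : ℝ} (hQ : 1 < Q) (hC : 0 ≤ C)
    (hμ : ∀ (x : X) (r : ℝ), 0 < r → μ (ball x r) ≤ ENNReal.ofReal (C * r ^ Q)) {κ : ℝ}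
    (hκ : 1 ≤ κ) :
    ∃ Λ a : ℝ, 1 < Λ ∧ 0 < a ∧ ∀ (x : X) (s : ℝ), 0 < s → ∀ E F : Set X, IsContinuum E →
      IsContinuum F → Disjoint E F → E ⊆ closedBall x s → F ⊆ closedBall x s →
      (∃ p ∈ E, ∃ q ∈ E, s / κ ≤ dist p q) → (∃ p ∈ F, ∃ q ∈ F, s / κ ≤ dist p q) →
      ∀ g : X → ℝ≥0∞, Measurable g → ∀ m : ℝ, 0 < m →
        ∫⁻ y in ball x (Λ * s), g y ^ Q ∂μ ≤ ENNReal.ofReal ((m * (Λ * s)) ^ Q) →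
        ∃ γ ∈ joiningCurves E F (ball x (Λ * s)), γ.lineIntegral g < ENNReal.ofReal (a * m * s) := by
  obtain ⟨Λ, c, hΛ, hc, H⟩ := h.exists_energy_le hQ hC hμ hκ
  have hΛ0 : 0 < Λ := one_pos.trans hΛ
  have hQ0 : 0 < Q := one_pos.trans hQ
  refine ⟨Λ, Λ * (2 / c) ^ (1 / Q), hΛ, by positivity, ?_⟩
  intro x s hs E F hE hF hEF hEs hFs hp hq g hg m hm hint
  by_contra! hcon
  have h1 := (H x s hs E F hE hF hEF hEs hFs hp hq g hg _ (by positivity) hcon).trans hint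
  rw [ENNReal.ofReal_le_ofReal_iff (by positivity),
    show Λ * (2 / c) ^ (1 / Q) * m * s = (2 / c) ^ (1 / Q) * (m * (Λ * s)) by ring,
    Real.mul_rpow (by positivity) (by positivity), ← Real.rpow_mul (by positivity),
    one_div_mul_cancel hQ0.ne', Real.rpow_one, ← mul_assoc, mul_div_cancel₀ _ hc.ne'] at h1
  have : 0 < (m * (Λ * s)) ^ Q := by positivity
  linarith

/-- Two large continua contain points at which the values of `v` are close. -/
theorem IsLoewner.exists_abs_sub_le (h : IsLoewner Q X μ) {C : ℝ} (hQ : 1 < Q) (hC : 0 ≤ C)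
    (hμ : ∀ (x : X) (r : ℝ), 0 < r → μ (ball x r) ≤ ENNReal.ofReal (C * r ^ Q)) {κ : ℝ}
    (hκ : 1 ≤ κ) :
    ∃ Λ a : ℝ, 1 < Λ ∧ 0 < a ∧ ∀ (x : X) (s : ℝ), 0 < s → ∀ E F : Set X, IsContinuum E →
      IsContinuum F → E ⊆ closedBall x s → F ⊆ closedBall x s →
      (∃ p ∈ E, ∃ q ∈ E, s / κ ≤ dist p q) → (∃ p ∈ F, ∃ q ∈ F, s / κ ≤ dist p q) →
      ∀ g : X → ℝ≥0∞, Measurable g → ∀ v : X → ℝ,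
        (∀ γ : Curve X, ∀ s ∈ γ.carrier, ∀ t ∈ γ.carrier,
          ENNReal.ofReal |v (γ.toFun t) - v (γ.toFun s)| ≤ γ.lineIntegral g) → ∀ m : ℝ, 0 < m →
        ∫⁻ y in ball x (Λ * s), g y ^ Q ∂μ ≤ ENNReal.ofReal ((m * (Λ * s)) ^ Q) →
        ∃ p ∈ E, ∃ q ∈ F, |v p - v q| ≤ a * m * s := by
  obtain ⟨Λ, a, hΛ, ha, H⟩ := h.exists_lineIntegral_lt hQ hC hμ hκ
  refine ⟨Λ, a, hΛ, ha, ?_⟩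
  intro x s hs E F hE hF hEs hFs hp hq g hg v hv m hm hint
  by_cases hEF : Disjoint E F
  · obtain ⟨γ, ⟨-, ⟨b, hb, hbE⟩, d, hd, hdF⟩, hlt⟩ :=
      H x s hs E F hE hF hEF hEs hFs hp hq g hg m hm hint
    exact ⟨_, hbE, _, hdF, (ENNReal.ofReal_le_ofReal_iff (by positivity)).1
      ((hv γ d hd b hb).trans hlt.le)⟩
  · obtain ⟨z, hzE, hzF⟩ := not_disjoint_iff.1 hEF
    exact ⟨z, hzE, z, hzF, by rw [sub_self, abs_zero]; positivity⟩

/-- At each scale there is a large continuum near `x` on which `v` has small oscillation. -/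
theorem IsLoewner.exists_continuum_osc_le (h : IsLoewner Q X μ) (hconv : IsQuasiconvexSpace X)
    {C : ℝ} (hQ : 1 < Q) (hC : 0 ≤ C)
    (hμ : ∀ (x : X) (r : ℝ), 0 < r → μ (ball x r) ≤ ENNReal.ofReal (C * r ^ Q)) :
    ∃ Λ a : ℝ, 1 < Λ ∧ 0 < a ∧ ∀ (x y : X) (s : ℝ), 0 < s → s ≤ dist y x →
      ∀ g : X → ℝ≥0∞, Measurable g → ∀ v : X → ℝ,
        (∀ γ : Curve X, ∀ s ∈ γ.carrier, ∀ t ∈ γ.carrier,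
          ENNReal.ofReal |v (γ.toFun t) - v (γ.toFun s)| ≤ γ.lineIntegral g) → ∀ m : ℝ, 0 < m →
        ∫⁻ y in ball x (Λ * s), g y ^ Q ∂μ ≤ ENNReal.ofReal ((m * (Λ * s)) ^ Q) →
        ∃ G : Set X, IsContinuum G ∧ G ⊆ closedBall x (Λ * s) ∧
          (∃ p ∈ G, ∃ q ∈ G, s / 4 ≤ dist p q) ∧ ∀ p ∈ G, ∀ q ∈ G, |v p - v q| ≤ a * m * s := by
  obtain ⟨Λ, a, hΛ, ha, H⟩ := h.exists_lineIntegral_lt hQ hC hμ (κ := 4) (by norm_num)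
  refine ⟨Λ, a, hΛ, ha, ?_⟩
  intro x y s hs hsy g hg v hv m hm hint
  obtain ⟨E, hE, hEd, hEp⟩ := hconv.exists_continuum x y (α := 0) (β := s / 4) le_rfl
    (by linarith) (by linarith)
  obtain ⟨F, hF, hFd, p, hp, q, hq, hpq⟩ := hconv.exists_continuum x y (α := s / 2) (β := s)
    (by linarith) (by linarith) hsy
  have hEF : Disjoint E F := disjoint_left.2 fun z h1 h2 => by
    linarith [(hEd z h1).2, (hFd z h2).1]
  obtain ⟨γ, ⟨hγ, ⟨b, hb, hbE⟩, d, hd, hdF⟩, hlt⟩ := H x s hs E F hE hF hEF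
    (fun z hz => mem_closedBall.2 (by linarith [(hEd z hz).2]))
    (fun z hz => mem_closedBall.2 (hFd z hz).2) (by simpa using hEp)
    ⟨p, hp, q, hq, by linarith⟩ g hg m hm hint
  obtain ⟨G, hGγ, hG, hbG, hdG⟩ := γ.exists_continuum hb hd
  refine ⟨G, hG, (hGγ.trans hγ).trans ball_subset_closedBall, ⟨_, hbG, _, hdG, ?_⟩, ?_⟩
  · rw [dist_comm]
    linarith [dist_triangle (γ.toFun d) (γ.toFun b) x, (hEd _ hbE).2, (hFd _ hdF).1]
  · intro p hp q hq
    obtain ⟨s, hs, rfl⟩ := hGγ hp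
    obtain ⟨t, ht, rfl⟩ := hGγ hq
    exact (ENNReal.ofReal_le_ofReal_iff (by positivity)).1 ((hv γ t ht s hs).trans hlt.le)

/-- The pointwise estimate in a Loewner space for continuous functions. -/
theorem IsLoewner.abs_sub_le_of_continuous (h : IsLoewner Q X μ) (hconv : IsQuasiconvexSpace X)
    {C : ℝ} (hQ : 1 < Q) (hC : 0 ≤ C)
    (hμ : ∀ (x : X) (r : ℝ), 0 < r → μ (ball x r) ≤ ENNReal.ofReal (C * r ^ Q)) :
    ∃ Λ a : ℝ, 1 ≤ Λ ∧ 0 < a ∧ ∀ g : X → ℝ≥0∞, Measurable g → ∀ v : X → ℝ, Continuous v →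
      (∀ γ : Curve X, ∀ s ∈ γ.carrier, ∀ t ∈ γ.carrier,
        ENNReal.ofReal |v (γ.toFun t) - v (γ.toFun s)| ≤ γ.lineIntegral g) →
      ∀ (x y : X) (m : ℝ), x ≠ y → 0 < m →
        (∀ z ∈ ({x, y} : Set X), ∀ s, 0 < s → s ≤ Λ * dist x y →
          ∫⁻ y in ball z s, g y ^ Q ∂μ ≤ ENNReal.ofReal ((m * s) ^ Q)) →
        |v x - v y| ≤ a * m * dist x y := by
  obtain ⟨Λ₁, a₁, hΛ₁, ha₁, H₁⟩ := h.exists_continuum_osc_le hconv hQ hC hμ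
  obtain ⟨Λ₂, a₂, hΛ₂, ha₂, H₂⟩ := h.exists_abs_sub_le hQ hC hμ (κ := 8 * (Λ₁ + 1)) (by linarith)
  set b := 2 * (2 * a₁ + a₂ * (Λ₁ + 1)) with hb
  have hb0 : 0 < b := by positivity
  have hΛ₁' : Λ₁ ≤ Λ₂ * (Λ₁ + 1) := by nlinarith
  refine ⟨Λ₂ * (Λ₁ + 1), 2 * (b + a₁) + a₂ * (Λ₁ + 1), by linarith, by positivity, ?_⟩
  intro g hg v hvc hv x y m hxy hm hint
  set r := dist x y with hr
  have hr0 : 0 < r := dist_pos.2 hxy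
  have hint₁ : ∀ z ∈ ({x, y} : Set X), ∀ s, 0 < s → s ≤ r →
      ∫⁻ y in ball z (Λ₁ * s), g y ^ Q ∂μ ≤ ENNReal.ofReal ((m * (Λ₁ * s)) ^ Q) :=
    fun z hz s hs hsr => hint z hz _ (by positivity)
      ((mul_le_mul_of_nonneg_left hsr (by positivity)).trans
        (mul_le_mul_of_nonneg_right hΛ₁' hr0.le))
  have hint₂ : ∀ z ∈ ({x, y} : Set X), ∀ s, 0 < s → s ≤ r →
      ∫⁻ y in ball z (Λ₂ * ((Λ₁ + 1) * s)), g y ^ Q ∂μ ≤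
        ENNReal.ofReal ((m * (Λ₂ * ((Λ₁ + 1) * s))) ^ Q) :=
    fun z hz s hs hsr => hint z hz _ (by positivity) (by
      rw [← mul_assoc]; exact mul_le_mul_of_nonneg_left hsr (by positivity))
  have hend : ∀ z ∈ ({x, y} : Set X), ∃ G : Set X, IsContinuum G ∧ G ⊆ closedBall z (Λ₁ * r) ∧
      (∃ p ∈ G, ∃ q ∈ G, r / 4 ≤ dist p q) ∧ ∀ p ∈ G, |v p - v z| ≤ (b + a₁) * m * r := by
    intro z hz
    obtain ⟨z', hz'⟩ : ∃ z', r ≤ dist z' z := by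
      rcases hz with rfl | rfl
      · exact ⟨y, by rw [dist_comm]⟩
      · exact ⟨x, le_rfl⟩
    have hpos : ∀ k : ℕ, 0 < r / 2 ^ k := fun k => by positivity
    have hler : ∀ k : ℕ, r / 2 ^ k ≤ r := fun k => div_le_self hr0.le (one_le_pow₀ (by norm_num))
    choose G hG hGs hGp hGo using fun k : ℕ => H₁ z z' (r / 2 ^ k) (hpos k)
      ((hler k).trans hz') g hg v hv m hm (hint₁ z hz _ (hpos k) (hler k))
    choose p hp using fun k => (hG k).2.nonempty
    have hstep : ∀ k, dist (v (p k)) (v (p (k + 1))) ≤ b * m * r / 2 / 2 ^ k := by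
      intro k
      have hk : r / 2 ^ (k + 1) = r / 2 ^ k / 2 := by rw [pow_succ, div_div]
      have hsub : G k ⊆ closedBall z ((Λ₁ + 1) * (r / 2 ^ k)) := (hGs k).trans
        (closedBall_subset_closedBall (by nlinarith [hpos k]))
      have hsub' : G (k + 1) ⊆ closedBall z ((Λ₁ + 1) * (r / 2 ^ k)) := (hGs (k + 1)).trans
        (closedBall_subset_closedBall (by rw [hk]; nlinarith [hpos k]))
      have hκ : (Λ₁ + 1) * (r / 2 ^ k) / (8 * (Λ₁ + 1)) = r / 2 ^ k / 2 / 4 := by field_simp; norm_num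
      obtain ⟨p₁, hp₁, q₁, hq₁, hpq₁⟩ := hGp k
      have hGp' := hGp (k + 1)
      rw [hk, ← hκ] at hGp'
      obtain ⟨p', hp', q', hq', hpq⟩ := H₂ z _ (by have := hpos k; positivity) _ _ (hG k)
        (hG (k + 1)) hsub hsub' ⟨p₁, hp₁, q₁, hq₁, by rw [hκ]; linarith [hpos k]⟩ hGp' g hg v hv m hm
        (hint₂ z hz _ (hpos k) (hler k))
      have h1 := hGo k _ (hp k) _ hp'
      have h2 := hGo (k + 1) _ hq' _ (hp (k + 1))
      rw [hk] at h2
      have h3 : a₁ * m * (r / 2 ^ k / 2) ≤ a₁ * m * (r / 2 ^ k) :=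
        mul_le_mul_of_nonneg_left (by linarith [hpos k]) (by positivity)
      rw [Real.dist_eq, show b * m * r / 2 / 2 ^ k = a₁ * m * (r / 2 ^ k) +
        a₂ * m * ((Λ₁ + 1) * (r / 2 ^ k)) + a₁ * m * (r / 2 ^ k) by rw [hb]; ring]
      have h4 := abs_sub_le (v (p k)) (v p') (v (p (k + 1)))
      have h5 := abs_sub_le (v p') (v q') (v (p (k + 1)))
      linarith
    have hlim : Tendsto p atTop (nhds z) := by
      rw [tendsto_iff_dist_tendsto_zero]
      refine squeeze_zero (fun _ => dist_nonneg) (fun k => mem_closedBall.1 (hGs k (hp k))) ?_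
      have : Tendsto (fun k : ℕ => Λ₁ * (r * (1 / 2) ^ k)) atTop (nhds (Λ₁ * (r * 0))) :=
        ((_root_.tendsto_pow_atTop_nhds_zero_of_lt_one (by norm_num) (by norm_num)).const_mul _).const_mul _
      simpa [div_eq_mul_inv] using this
    have hfin := dist_le_of_le_geometric_two_of_tendsto₀ hstep ((hvc.tendsto z).comp hlim)
    have hG0 := hGs 0
    have hGp0 := hGp 0
    have hGo0 := hGo 0
    simp only [pow_zero, div_one] at hG0 hGp0 hGo0
    refine ⟨G 0, hG 0, hG0, hGp0, fun q hq => ?_⟩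
    have h1 := hGo0 _ hq _ (hp 0)
    rw [Real.dist_eq] at hfin
    have h2 := abs_sub_le (v q) (v (p 0)) (v z)
    linarith
  obtain ⟨G, hG, hGs, ⟨p₁, hp₁, q₁, hq₁, hpq₁⟩, hGo⟩ := hend x (by simp)
  obtain ⟨F, hF, hFs, ⟨p₂, hp₂, q₂, hq₂, hpq₂⟩, hFo⟩ := hend y (by simp)
  have hκ : (Λ₁ + 1) * r / (8 * (Λ₁ + 1)) = r / 8 := by field_simp
  obtain ⟨p, hp, q, hq, hpq⟩ := H₂ x ((Λ₁ + 1) * r) (by positivity) G F hG hF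
    (hGs.trans (closedBall_subset_closedBall (by linarith)))
    (hFs.trans (closedBall_subset_closedBall' (by rw [dist_comm y x]; linarith)))
    ⟨p₁, hp₁, q₁, hq₁, by rw [hκ]; linarith⟩ ⟨p₂, hp₂, q₂, hq₂, by rw [hκ]; linarith⟩ g hg v hv m hm
    (hint₂ x (by simp) r hr0 le_rfl)
  have h1 := hGo p hp
  have h2 := hFo q hq
  rw [abs_sub_comm] at h1
  have h3 := abs_sub_le (v x) (v p) (v y)
  have h4 := abs_sub_le (v p) (v q) (v y)
  linarith

end Pointwise

section PoincareOfLoewner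

variable [MeasurableSpace X] [BorelSpace X] {μ : Measure X} {Q : ℝ}

/-- The pointwise estimate in a Loewner space, for functions with a lower semicontinuous upper
gradient bounded away from zero. -/
theorem IsLoewner.abs_sub_le_of_isUpperGradient [ProperSpace X] (h : IsLoewner Q X μ)
    (hconv : IsQuasiconvexSpace X) {C : ℝ} (hQ : 1 < Q) (hC : 0 ≤ C)
    (hμ : ∀ (x : X) (r : ℝ), 0 < r → μ (ball x r) ≤ ENNReal.ofReal (C * r ^ Q)) :
    ∃ Λ a : ℝ, 1 ≤ Λ ∧ 0 < a ∧ ∀ ρ : X → ℝ≥0∞, LowerSemicontinuous ρ → ∀ ε : ℝ, 0 < ε →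
      (∀ x, ENNReal.ofReal ε ≤ ρ x) → ∀ u : X → ℝ, IsUpperGradient ρ u →
      ∀ (x y : X) (m : ℝ), x ≠ y → 0 < m →
        (∀ z ∈ ({x, y} : Set X), ∀ s, 0 < s → s ≤ Λ * dist x y →
          ∫⁻ y in ball z s, ρ y ^ Q ∂μ ≤ ENNReal.ofReal ((m * s) ^ Q)) →
        |u x - u y| ≤ a * m * dist x y := by
  obtain ⟨Λ, a, hΛ, ha, H⟩ := h.abs_sub_le_of_continuous hconv hQ hC hμ
  refine ⟨Λ, a, hΛ, ha, ?_⟩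
  intro ρ hρ ε hε hρε u hu x y m hxy hm hint
  have hA : 0 ≤ a * m * dist x y := by positivity
  refine le_of_forall_gt_imp_ge_of_dense fun A hAA => ?_
  have hA0 : 0 ≤ A := hA.trans hAA.le
  obtain ⟨γ, L, hL, hcar, h0, h1, hrect, hle⟩ := exists_curve_of_chainCost_lt hρ hε hρε
    (isCompact_singleton (x := x)) (isClosed_singleton (x := y)) hA0 fun n => ⟨y, rfl, by
      have hn : (0 : ℝ) < 1 / ((n : ℝ) + 1) := by positivity
      have h1 := H ρ hρ.measurable (chainDist ρ (1 / ((n : ℝ) + 1)) {x} A)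
        (continuous_chainDist ρ hn _ _)
        (fun γ s hs t ht => ofReal_abs_chainDist_sub_le_lineIntegral ρ hn _ _ γ hs ht) x y m hxy hm
        hint
      rw [chainDist_eq_zero ρ _ A (mem_singleton x), zero_sub, abs_neg,
        abs_of_nonneg (chainDist_nonneg _ _ _ _ _)] at h1
      exact (chainCost_le_of_chainDist_le hAA h1).trans_lt
        ((ENNReal.ofReal_lt_ofReal_iff (hA.trans_lt hAA)).2 hAA)⟩
  rw [mem_singleton_iff] at h0 h1
  have h2 := hu γ 0 L hL hcar hrect fun hconst => hxy (by
    rw [← h0, ← h1]; exact (hconst L (hcar ▸ right_mem_Icc.2 hL)).symm)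
  rw [h0, h1, abs_sub_comm] at h2
  exact (ENNReal.ofReal_le_ofReal_iff hA0).1 (h2.trans hle)

theorem lintegral_abs_sub_average_le {α : Type*} [MeasurableSpace α] (ν : Measure α)
    [IsFiniteMeasure ν] {u : α → ℝ} (hu : AEStronglyMeasurable u ν) (c : ℝ) :
    ∫⁻ y, ENNReal.ofReal |u y - ⨍ z, u z ∂ν| ∂ν ≤ 2 * ∫⁻ y, ENNReal.ofReal |u y - c| ∂ν := by
  rcases eq_or_ne ν 0 with rfl | hν
  · simp
  have : NeZero ν := ⟨hν⟩
  by_cases hfin : ∫⁻ y, ENNReal.ofReal |u y - c| ∂ν = ⊤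
  · rw [hfin]; simp
  have hint : Integrable (fun y => u y - c) ν := by
    refine ⟨hu.sub aestronglyMeasurable_const, ?_⟩
    rw [hasFiniteIntegral_iff_norm]
    exact lt_top_iff_ne_top.2 hfin
  have hui : Integrable u ν := (hint.add (integrable_const c)).congr
    (ae_of_all _ fun y => sub_add_cancel (u y) c)
  have havg : ENNReal.ofReal |c - ⨍ z, u z ∂ν| * ν univ ≤ ∫⁻ y, ENNReal.ofReal |u y - c| ∂ν := by
    have e1 : ν.real univ * (⨍ z, u z ∂ν - c) = ∫ y, (u y - c) ∂ν := by
      rw [integral_sub hui (integrable_const c), integral_const, mul_sub, smul_eq_mul,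
        ← measure_smul_average ν u, smul_eq_mul]
    have e2 : |c - ⨍ z, u z ∂ν| * ν.real univ ≤ ∫ y, |u y - c| ∂ν := by
      rw [abs_sub_comm, mul_comm, ← abs_of_nonneg (measureReal_nonneg (μ := ν) (s := univ)), ← abs_mul,
        e1]
      exact abs_integral_le_integral_abs
    rw [← ofReal_integral_eq_lintegral_ofReal hint.abs (ae_of_all _ fun _ => abs_nonneg _)]
    rw [← ofReal_measureReal, ← ENNReal.ofReal_mul (abs_nonneg _)]
    exact ENNReal.ofReal_le_ofReal e2
  calc ∫⁻ y, ENNReal.ofReal |u y - ⨍ z, u z ∂ν| ∂ν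
      ≤ ∫⁻ y, (ENNReal.ofReal |u y - c| + ENNReal.ofReal |c - ⨍ z, u z ∂ν|) ∂ν := by
        refine lintegral_mono fun y => ?_
        rw [← ENNReal.ofReal_add (abs_nonneg _) (abs_nonneg _)]
        exact ENNReal.ofReal_le_ofReal (abs_sub_le _ _ _)
    _ = ∫⁻ y, ENNReal.ofReal |u y - c| ∂ν + ENNReal.ofReal |c - ⨍ z, u z ∂ν| * ν univ := by
        rw [lintegral_add_right _ measurable_const, lintegral_const]
    _ ≤ _ := by rw [two_mul]; exact add_le_add_right havg _

/-- The weak type estimate for the restricted fractional maximal function. -/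
theorem measure_exists_lt_lintegral_ball_le [TopologicalSpace.SeparableSpace X] {C : ℝ}
    (hC : 0 ≤ C)
    (hμ : ∀ (x : X) (r : ℝ), 0 < r → μ (ball x r) ≤ ENNReal.ofReal (C * r ^ Q)) (S D : Set X)
    (R : ℝ) (f : X → ℝ≥0∞) (hD : ∀ z ∈ S, ball z R ⊆ D) {j m : ℝ} (hm : 0 < m)
    (hf : ∫⁻ y in D, f y ∂μ ≤ ENNReal.ofReal j) :
    μ {z ∈ S | ∃ s, 0 < s ∧ s ≤ R ∧ ENNReal.ofReal ((m * s) ^ Q) < ∫⁻ y in ball z s, f y ∂μ} ≤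
      ENNReal.ofReal (C * 6 ^ Q * j / m ^ Q) := by
  set B := {z ∈ S | ∃ s, 0 < s ∧ s ≤ R ∧ ENNReal.ofReal ((m * s) ^ Q) < ∫⁻ y in ball z s, f y ∂μ}
  have hrad : ∀ z, ∃ s, z ∈ B → 0 < s ∧ s ≤ R ∧
      ENNReal.ofReal ((m * s) ^ Q) < ∫⁻ y in ball z s, f y ∂μ := fun z => by
    by_cases hz : z ∈ B
    · obtain ⟨s, hs⟩ := hz.2
      exact ⟨s, fun _ => hs⟩
    · exact ⟨0, fun h => absurd h hz⟩
  choose rad hrad using hrad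
  obtain ⟨u, huB, hu, hcov, hsum⟩ := exists_disjoint_ball_cover μ B rad R
    fun z hz => ⟨(hrad z hz).1, (hrad z hz).2.1⟩
  have : Countable u := hu
  have hK : 0 ≤ C * 6 ^ Q / m ^ Q := by positivity
  calc μ B ≤ μ (⋃ z ∈ u, closedBall z (5 * rad z)) := measure_mono hcov
    _ ≤ ∑' z : u, μ (closedBall (z : X) (5 * rad z)) := measure_biUnion_le μ hu _
    _ ≤ ∑' z : u, ENNReal.ofReal (C * 6 ^ Q / m ^ Q) * ∫⁻ y in ball (z : X) (rad z), f y ∂μ := by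
        refine ENNReal.tsum_le_tsum fun z => ?_
        obtain ⟨h0, -, h1⟩ := hrad z (huB z.2)
        calc μ (closedBall (z : X) (5 * rad z)) ≤ μ (ball (z : X) (6 * rad z)) :=
              measure_mono (closedBall_subset_ball (by linarith))
          _ ≤ ENNReal.ofReal (C * (6 * rad z) ^ Q) := hμ _ _ (by positivity)
          _ = ENNReal.ofReal (C * 6 ^ Q / m ^ Q) * ENNReal.ofReal ((m * rad z) ^ Q) := by
              rw [← ENNReal.ofReal_mul hK, Real.mul_rpow (by norm_num) h0.le,
                Real.mul_rpow hm.le h0.le]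
              congr 1; field_simp
          _ ≤ _ := mul_le_mul_right h1.le _
    _ = ENNReal.ofReal (C * 6 ^ Q / m ^ Q) * ∑' z : u, ∫⁻ y in ball (z : X) (rad z), f y ∂μ :=
        ENNReal.tsum_mul_left
    _ ≤ ENNReal.ofReal (C * 6 ^ Q / m ^ Q) * ENNReal.ofReal j := by
        refine mul_le_mul_right ((hsum f D fun z hz => ?_).trans hf) _
        exact (ball_subset_ball (hrad z (huB hz)).2.1).trans (hD z (huB hz).1)
    _ = _ := by
        rw [← ENNReal.ofReal_mul hK]; congr 1; ring

/-- Integrating a function controlled off a sequence of exceptional sets. -/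
theorem lintegral_le_of_dyadic_exceptional {α : Type*} [MeasurableSpace α] (ν : Measure α)
    (hQ : 1 < Q) {f : α → ℝ≥0∞} {T : ℕ → Set α} {b c : ℝ} (hb : 0 ≤ b) (hc : 0 < c)
    (hT : ∀ i, ν (T i) ≤ ENNReal.ofReal (b / ((2 : ℝ) ^ i) ^ Q)) (hν : ν univ ≤ ENNReal.ofReal b)
    (hf : ∀ᵐ z ∂ν, ∀ i, z ∉ T i → f z ≤ ENNReal.ofReal (c * 2 ^ i)) :
    ∫⁻ z, f z ∂ν ≤ ENNReal.ofReal (c * b * (1 + 2 * (1 - 2 ^ (1 - Q))⁻¹)) := by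
  set q : ℝ := 2 ^ (1 - Q) with hq
  have hq0 : 0 < q := by positivity
  have hq1 : q < 1 := Real.rpow_lt_one_of_one_lt_of_neg (by norm_num) (by linarith)
  have hq2 : 0 < (1 - q)⁻¹ := inv_pos.2 (by linarith)
  set h : α → ℝ≥0∞ := fun z => ENNReal.ofReal c * (1 + ∑' i,
    (toMeasurable ν (T i)).indicator (fun _ => ENNReal.ofReal (2 * 2 ^ i)) z) with hh
  have hfh : ∀ᵐ z ∂ν, f z ≤ h z := by
    filter_upwards [hf] with z hz
    by_cases hex : ∃ i, z ∉ T i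
    · classical
      set k := Nat.find hex with hk
      have hk1 := hz k (Nat.find_spec hex)
      rw [ENNReal.ofReal_mul hc.le] at hk1
      refine hk1.trans (mul_le_mul_right ?_ _)
      rcases Nat.eq_zero_or_pos k with h0 | h0
      · rw [h0, pow_zero, ENNReal.ofReal_one]
        exact le_self_add
      · have hmem : z ∈ T (k - 1) := by
          by_contra hcon
          exact Nat.find_min hex (m := k - 1) (by omega) hcon
        refine le_trans ?_ le_add_self
        refine le_trans (le_of_eq ?_) (ENNReal.le_tsum (k - 1))
        rw [indicator_of_mem (subset_toMeasurable ν _ hmem), ← pow_succ',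
          Nat.sub_add_cancel h0]
    · push Not at hex
      have htop : ∑' i : ℕ, (toMeasurable ν (T i)).indicator
          (fun _ => ENNReal.ofReal (2 * 2 ^ i)) z = ⊤ := by
        refine top_unique ?_
        rw [← ENNReal.tsum_const_eq_top_of_ne_zero (α := ℕ) (c := 1) one_ne_zero]
        refine ENNReal.tsum_le_tsum fun i => ?_
        rw [indicator_of_mem (subset_toMeasurable ν _ (hex i)), ENNReal.one_le_ofReal]
        linarith [one_le_pow₀ (M₀ := ℝ) (a := 2) (n := i) (by norm_num)]
      rw [hh]
      simp only [htop, add_top]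
      rw [ENNReal.mul_top (ENNReal.ofReal_pos.2 hc).ne']
      exact le_top
  refine (lintegral_mono_ae hfh).trans ?_
  have hmeas : ∀ i : ℕ, Measurable
      ((toMeasurable ν (T i)).indicator fun _ => ENNReal.ofReal (2 * 2 ^ i)) := fun i =>
    measurable_const.indicator (measurableSet_toMeasurable _ _)
  have hterm : ∀ i : ℕ, ∫⁻ z, (toMeasurable ν (T i)).indicator
      (fun _ => ENNReal.ofReal (2 * 2 ^ i)) z ∂ν ≤ ENNReal.ofReal (2 * b * q ^ i) := fun i => by
    rw [lintegral_indicator_const (measurableSet_toMeasurable _ _), measure_toMeasurable]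
    refine (mul_le_mul_right (hT i) _).trans (le_of_eq ?_)
    rw [← ENNReal.ofReal_mul (by positivity)]
    congr 1
    have : q ^ i = 2 ^ i / ((2 : ℝ) ^ i) ^ Q := by
      rw [hq, ← Real.rpow_natCast, ← Real.rpow_natCast, ← Real.rpow_mul (by norm_num),
        ← Real.rpow_mul (by norm_num), ← Real.rpow_sub (by norm_num)]
      congr 1; ring
    rw [this]; ring
  have hsum : ∑' i : ℕ, ENNReal.ofReal (2 * b * q ^ i) = ENNReal.ofReal (2 * b * (1 - q)⁻¹) := by
    rw [← ENNReal.ofReal_tsum_of_nonneg (fun i => by positivity)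
      ((summable_geometric_of_lt_one hq0.le hq1).mul_left _), tsum_mul_left,
      tsum_geometric_of_lt_one hq0.le hq1]
  calc ∫⁻ z, h z ∂ν = ENNReal.ofReal c * (ν univ + ∑' i, ∫⁻ z, (toMeasurable ν (T i)).indicator
      (fun _ => ENNReal.ofReal (2 * 2 ^ i)) z ∂ν) := by
        rw [hh, lintegral_const_mul' _ _ ENNReal.ofReal_ne_top, lintegral_add_left measurable_const,
          lintegral_one, lintegral_tsum fun i => (hmeas i).aemeasurable]
    _ ≤ ENNReal.ofReal c * (ENNReal.ofReal b + ENNReal.ofReal (2 * b * (1 - q)⁻¹)) :=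
        mul_le_mul_right (add_le_add hν ((ENNReal.tsum_le_tsum hterm).trans hsum.le)) _
    _ = _ := by
        rw [← ENNReal.ofReal_add hb (by positivity), ← ENNReal.ofReal_mul hc.le]
        congr 1; ring

theorem IsLoewner.exists_lintegral_abs_sub_le [Nontrivial X] [ProperSpace X]
    [IsLocallyFiniteMeasure μ] (h : IsLoewner Q X μ) (hconv : IsQuasiconvexSpace X)
    (hreg : AhlforsRegular Q μ) (hQ : 1 < Q) :
    ∃ τ C : ℝ, 0 < τ ∧ 0 < C ∧ ∀ ρ : X → ℝ≥0∞, LowerSemicontinuous ρ → ∀ ε : ℝ, 0 < ε →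
      (∀ x, ENNReal.ofReal ε ≤ ρ x) → ∀ u : X → ℝ, IsUpperGradient ρ u → ∀ (x : X) (r j : ℝ),
      0 < r → 0 < j → ∫⁻ y in ball x (τ * r), ρ y ^ Q ∂μ ≤ ENNReal.ofReal j →
      ∃ c : ℝ, ∫⁻ y in ball x r, ENNReal.ofReal |u y - c| ∂μ ≤
        ENNReal.ofReal (C * r * (j / (μ (ball x r)).toReal) ^ (1 / Q) * (μ (ball x r)).toReal) := by
  have hQ0 : 0 < Q := one_pos.trans hQ
  obtain ⟨C, hC, hμ⟩ := hreg.exists_measure_ball_le hQ0.le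
  obtain ⟨Λ, a, hΛ, ha, H⟩ := h.abs_sub_le_of_isUpperGradient hconv hQ hC.le hμ
  have hΛ0 : 0 < Λ := one_pos.trans_le hΛ
  have hq1 : (2 : ℝ) ^ (1 - Q) < 1 := Real.rpow_lt_one_of_one_lt_of_neg (by norm_num) (by linarith)
  have hq2 : 0 < (1 - (2 : ℝ) ^ (1 - Q))⁻¹ := inv_pos.2 (by linarith)
  set S := 1 + 2 * (1 - (2 : ℝ) ^ (1 - Q))⁻¹ with hS
  have hS0 : 0 < S := by positivity
  set K := C * 6 ^ Q with hK
  have hK0 : 0 < K := by positivity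
  refine ⟨2 * Λ + 1, 2 * a * (2 * K) ^ (1 / Q) * S, by positivity, by positivity, ?_⟩
  intro ρ hρ ε hε hρε u hu x r j hr hj hint
  have hBt : μ (ball x r) ≠ ⊤ := measure_ball_lt_top.ne
  set b := (μ (ball x r)).toReal with hb
  have hb0 : 0 < b := ENNReal.toReal_pos (hreg.measure_ball_pos x hr).ne' hBt
  have hbe : μ (ball x r) = ENNReal.ofReal b := (ENNReal.ofReal_toReal hBt).symm
  set l := (2 * K * j / b) ^ (1 / Q) with hl
  have hl0 : 0 < l := by positivity
  have hlQ : l ^ Q = 2 * K * j / b := by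
    rw [hl, ← Real.rpow_mul (by positivity), one_div_mul_cancel hQ0.ne', Real.rpow_one]
  set T : ℝ → Set X := fun m => {z ∈ ball x r | ∃ s, 0 < s ∧ s ≤ 2 * Λ * r ∧
    ENNReal.ofReal ((m * s) ^ Q) < ∫⁻ y in ball z s, ρ y ^ Q ∂μ} with hT
  have hTμ : ∀ m : ℝ, 0 < m → μ (T m) ≤ ENNReal.ofReal (K * j / m ^ Q) := fun m hm =>
    measure_exists_lt_lintegral_ball_le hC.le hμ (ball x r) (ball x ((2 * Λ + 1) * r)) (2 * Λ * r)
      (fun y => ρ y ^ Q) (fun z hz => ball_subset_ball' (by linarith [mem_ball.1 hz])) hm hint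
  have hTanti : ∀ m m' : ℝ, 0 < m → m ≤ m' → T m' ⊆ T m := by
    rintro m m' hm hmm z ⟨hz, s, hs, hsR, hlt⟩
    refine ⟨hz, s, hs, hsR, lt_of_le_of_lt (ENNReal.ofReal_le_ofReal ?_) hlt⟩
    exact Real.rpow_le_rpow (by positivity) (mul_le_mul_of_nonneg_right hmm hs.le) hQ0.le
  have hTi : ∀ i : ℕ, μ (T (2 ^ i * l)) ≤ ENNReal.ofReal (b / ((2 : ℝ) ^ i) ^ Q) := fun i => by
    refine (hTμ _ (by positivity)).trans (ENNReal.ofReal_le_ofReal ?_)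
    rw [Real.mul_rpow (by positivity) hl0.le, hlQ]
    have h2 : 0 < ((2 : ℝ) ^ i) ^ Q := by positivity
    rw [div_le_div_iff₀ (by positivity) h2]
    have : b * (((2 : ℝ) ^ i) ^ Q * (2 * K * j / b)) = 2 * (K * j * ((2 : ℝ) ^ i) ^ Q) := by
      field_simp
    rw [this]
    have : 0 < K * j * ((2 : ℝ) ^ i) ^ Q := by positivity
    linarith
  obtain ⟨x₁, hx₁, hx₁T⟩ : ∃ x₁ ∈ ball x r, x₁ ∉ T l := by
    by_contra! hcon
    have h1 := (measure_mono (show ball x r ⊆ T l from hcon)).trans (hTμ l hl0)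
    rw [hbe, hlQ, ENNReal.ofReal_le_ofReal_iff (by positivity)] at h1
    have : K * j / (2 * K * j / b) = b / 2 := by field_simp
    linarith
  refine ⟨u x₁, ?_⟩
  have hpt : ∀ᵐ z ∂μ.restrict (ball x r), ∀ i : ℕ, z ∉ T (2 ^ i * l) →
      ENNReal.ofReal |u z - u x₁| ≤ ENNReal.ofReal (2 * a * l * r * 2 ^ i) := by
    filter_upwards [ae_restrict_mem measurableSet_ball] with z hz i hzT
    refine ENNReal.ofReal_le_ofReal ?_
    rcases eq_or_ne z x₁ with rfl | hne
    · rw [sub_self, abs_zero]; positivity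
    have hd : dist z x₁ ≤ 2 * r := by
      linarith [dist_triangle_right z x₁ x, mem_ball.1 hz, mem_ball.1 hx₁]
    have hx₁T' : x₁ ∉ T (2 ^ i * l) := fun h' => hx₁T (hTanti l _ hl0
      (le_mul_of_one_le_left hl0.le (one_le_pow₀ (by norm_num))) h')
    refine (H ρ hρ ε hε hρε u hu z x₁ (2 ^ i * l) hne (by positivity) ?_).trans ?_
    · intro w hw s hs hsd
      have hw' : w ∈ ball x r ∧ w ∉ T (2 ^ i * l) := by
        rcases hw with rfl | rfl
        exacts [⟨hz, hzT⟩, ⟨hx₁, hx₁T'⟩]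
      by_contra! hcon
      exact hw'.2 ⟨hw'.1, s, hs, hsd.trans (by nlinarith), hcon⟩
    · calc a * (2 ^ i * l) * dist z x₁ ≤ a * (2 ^ i * l) * (2 * r) :=
            mul_le_mul_of_nonneg_left hd (by positivity)
        _ = _ := by ring
  refine (lintegral_le_of_dyadic_exceptional (μ.restrict (ball x r)) hQ (b := b) hb0.le
    (by positivity) (fun i => (Measure.restrict_apply_le _ _).trans (hTi i))
    (by rw [Measure.restrict_apply_univ, hbe]) hpt).trans (le_of_eq ?_)
  congr 1
  rw [← hS, hl, mul_div_assoc, Real.mul_rpow (by positivity) (by positivity)]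
  ring

theorem IsLoewner.supportsPoincare [ProperSpace X] [IsLocallyFiniteMeasure μ]
    (h : IsLoewner Q X μ) (hconv : IsQuasiconvexSpace X) (hreg : AhlforsRegular Q μ)
    (hQ : 1 < Q) : SupportsPoincare Q μ := by
  have hQ0 : 0 < Q := one_pos.trans hQ
  rcases subsingleton_or_nontrivial X with hX | hX
  · refine ⟨1, 1, one_pos, one_pos, fun x r hr u hu g hg hug => ?_⟩
    have : ∫⁻ y in ball x r, ENNReal.ofReal |u y - ⨍ z in ball x r, u z ∂μ| ∂μ = 0 := by
      refine le_antisymm ((lintegral_abs_sub_average_le (μ.restrict (ball x r))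
        hu.aestronglyMeasurable (u x)).trans (le_of_eq ?_)) zero_le
      have : ∀ y, ENNReal.ofReal |u y - u x| = 0 := fun y => by
        rw [Subsingleton.elim y x, sub_self, abs_zero, ENNReal.ofReal_zero]
      simp [this]
    rw [this, ENNReal.zero_div]
    exact zero_le
  obtain ⟨τ, C, hτ, hC, H⟩ := h.exists_lintegral_abs_sub_le hconv hreg hQ
  obtain ⟨D, hD, hdoub⟩ := hreg.exists_doubling hQ0.le hτ
  have hD0 : 0 < D := one_pos.trans_le hD
  refine ⟨τ, 2 * C * D ^ (1 / Q), hτ, by positivity, fun x r hr u hu g hg hug => ?_⟩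
  have hC' : 0 < 2 * C * D ^ (1 / Q) * r := by positivity
  have hBt : μ (ball x r) ≠ ⊤ := measure_ball_lt_top.ne
  have hB't : μ (ball x (τ * r)) ≠ ⊤ := measure_ball_lt_top.ne
  have hB'0 : μ (ball x (τ * r)) ≠ 0 := (hreg.measure_ball_pos x (by positivity)).ne'
  set I := ∫⁻ y in ball x (τ * r), g y ^ Q ∂μ with hI
  rcases eq_or_ne I ⊤ with hIt | hIt
  · rw [hIt, ENNReal.top_div_of_ne_top hB't, ENNReal.top_rpow_of_pos (by positivity),
      ENNReal.mul_top (ENNReal.ofReal_pos.2 hC').ne']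
    exact le_top
  have hlim : Tendsto (fun J : ℝ≥0∞ => ENNReal.ofReal (2 * C * D ^ (1 / Q) * r) *
      (J / μ (ball x (τ * r))) ^ (1 / Q)) (nhdsWithin I (Ioi I))
      (nhds (ENNReal.ofReal (2 * C * D ^ (1 / Q) * r) * (I / μ (ball x (τ * r))) ^ (1 / Q))) := by
    refine Tendsto.mono_left ?_ nhdsWithin_le_nhds
    refine ENNReal.Tendsto.const_mul ?_ (Or.inr ENNReal.ofReal_ne_top)
    exact (ENNReal.continuous_rpow_const.tendsto _).comp
      (ENNReal.Tendsto.div_const tendsto_id (Or.inr hB'0))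
  have : (nhdsWithin I (Ioi I)).NeBot := nhdsGT_neBot_of_exists_gt ⟨⊤, lt_top_iff_ne_top.2 hIt⟩
  refine ge_of_tendsto hlim ?_
  filter_upwards [self_mem_nhdsWithin, nhdsWithin_le_nhds (Iio_mem_nhds (lt_top_iff_ne_top.2 hIt))]
    with J hIJ hJt
  rw [mem_Ioi] at hIJ
  rw [mem_Iio] at hJt
  obtain ⟨ρ, hρ, hgρ, ⟨ε, hε, hρε⟩, hρJ⟩ :=
    exists_lowerSemicontinuous_majorant μ hQ0 hg x (τ * r) hIJ
  have huρ : IsUpperGradient ρ u := fun γ a b hab hcar hrect hne =>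
    (hug γ a b hab hcar hrect hne).trans (γ.lineIntegral_mono fun s _ => hgρ _)
  set j := J.toReal with hj
  have hje : J = ENNReal.ofReal j := (ENNReal.ofReal_toReal hJt.ne).symm
  have hj0 : 0 < j := ENNReal.toReal_pos (pos_of_gt hIJ).ne' hJt.ne
  obtain ⟨c, hc⟩ := H ρ hρ ε hε hρε u huρ x r j hr hj0 (hρJ.trans hje.le)
  set b := (μ (ball x r)).toReal with hb
  set b' := (μ (ball x (τ * r))).toReal with hb'
  have hb0 : 0 < b := ENNReal.toReal_pos (hreg.measure_ball_pos x hr).ne' hBt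
  have hb'0 : 0 < b' := ENNReal.toReal_pos hB'0 hB't
  have hbe : μ (ball x r) = ENNReal.ofReal b := (ENNReal.ofReal_toReal hBt).symm
  have hb'e : μ (ball x (τ * r)) = ENNReal.ofReal b' := (ENNReal.ofReal_toReal hB't).symm
  have hbb : b' ≤ D * b := by
    have := hdoub x r hr
    rwa [hbe, hb'e, ← ENNReal.ofReal_mul hD0.le, ENNReal.ofReal_le_ofReal_iff (by positivity)] at this
  have : IsFiniteMeasure (μ.restrict (ball x r)) :=
    ⟨by rw [Measure.restrict_apply_univ]; exact measure_ball_lt_top⟩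
  have h1 := (lintegral_abs_sub_average_le (μ.restrict (ball x r)) hu.aestronglyMeasurable c).trans
    (mul_le_mul_right hc 2)
  rw [hbe, ENNReal.div_le_iff (ENNReal.ofReal_pos.2 hb0).ne' ENNReal.ofReal_ne_top, hje, hb'e,
    ← ENNReal.ofReal_div_of_pos hb'0, ENNReal.ofReal_rpow_of_nonneg (by positivity) (by positivity),
    ← ENNReal.ofReal_mul hC'.le, ← ENNReal.ofReal_mul (by positivity)]
  refine h1.trans ?_
  rw [show (2 : ℝ≥0∞) = ENNReal.ofReal 2 by simp, ← ENNReal.ofReal_mul (by norm_num)]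
  refine ENNReal.ofReal_le_ofReal ?_
  have h2 : (j / b) ^ (1 / Q) ≤ D ^ (1 / Q) * (j / b') ^ (1 / Q) := by
    rw [← Real.mul_rpow hD0.le (by positivity)]
    refine Real.rpow_le_rpow (by positivity) ?_ (by positivity)
    rw [← mul_div_assoc, div_le_div_iff₀ hb0 hb'0]
    nlinarith
  calc 2 * (C * r * (j / b) ^ (1 / Q) * b) = 2 * C * r * b * (j / b) ^ (1 / Q) := by ring
    _ ≤ 2 * C * r * b * (D ^ (1 / Q) * (j / b') ^ (1 / Q)) :=
        mul_le_mul_of_nonneg_left h2 (by positivity)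
    _ = _ := by ring

end PoincareOfLoewner

section PoincareToLoewner

theorem ofReal_abs_setAverage_sub_le {α : Type*} [MeasurableSpace α] {ν : Measure α} {s : Set α}
    (hs0 : ν s ≠ 0) (hst : ν s ≠ ⊤) {u : α → ℝ} (hu : IntegrableOn u s ν) (m : ℝ) :
    ENNReal.ofReal |⨍ y in s, u y ∂ν - m| ≤
      (∫⁻ y in s, ENNReal.ofReal |u y - m| ∂ν) / ν s := by
  have hconst : IntegrableOn (fun _ => m) s ν := integrableOn_const hst
  have hpos : 0 < (ν s).toReal := ENNReal.toReal_pos hs0 hst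
  have h1 : ⨍ y in s, u y ∂ν - m = (ν s).toReal⁻¹ * ∫ y in s, (u y - m) ∂ν := by
    rw [integral_sub hu hconst, setAverage_eq, setIntegral_const, smul_eq_mul, smul_eq_mul,
      Measure.real, mul_sub, inv_mul_cancel_left₀ hpos.ne']
  rw [h1, abs_mul, abs_of_pos (inv_pos.2 hpos), ENNReal.ofReal_mul (inv_pos.2 hpos).le,
    ENNReal.ofReal_inv_of_pos hpos, ENNReal.ofReal_toReal hst, mul_comm, ← div_eq_mul_inv]
  refine ENNReal.div_le_div_right ?_ _
  exact (ENNReal.ofReal_le_ofReal abs_integral_le_integral_abs).trans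
    (ofReal_integral_eq_lintegral_ofReal (hu.sub hconst).abs
      (Eventually.of_forall fun _ => abs_nonneg _)).le

theorem tendsto_setAverage_ball [MeasurableSpace X] [BorelSpace X] [ProperSpace X]
    {μ : Measure X} [IsLocallyFiniteMeasure μ] {u : X → ℝ} (hu : Continuous u) (z : X)
    {r : ℕ → ℝ} (hr : Tendsto r atTop (nhds 0)) (hpos : ∀ n, 0 < μ (ball z (r n))) :
    Tendsto (fun n => ⨍ y in ball z (r n), u y ∂μ) atTop (nhds (u z)) := by
  rw [Metric.tendsto_nhds]
  intro ε hε
  obtain ⟨δ, hδ, hδu⟩ := Metric.continuous_iff.1 hu z (ε / 2) (half_pos hε)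
  filter_upwards [hr.eventually (gt_mem_nhds hδ)] with n hn
  have hfin : μ (ball z (r n)) ≠ ⊤ := measure_ball_lt_top.ne
  have hint : IntegrableOn u (ball z (r n)) μ :=
    (hu.continuousOn.integrableOn_compact (isCompact_closedBall z (r n))).mono_set
      ball_subset_closedBall
  have h1 := ofReal_abs_setAverage_sub_le (hpos n).ne' hfin hint (u z)
  have h2 : ∫⁻ y in ball z (r n), ENNReal.ofReal |u y - u z| ∂μ ≤
      ENNReal.ofReal (ε / 2) * μ (ball z (r n)) := by
    rw [← setLIntegral_const]
    refine setLIntegral_mono measurable_const fun y hy => ENNReal.ofReal_le_ofReal ?_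
    exact (hδu y ((mem_ball.1 hy).trans hn)).le
  have h3 : ENNReal.ofReal |⨍ y in ball z (r n), u y ∂μ - u z| ≤ ENNReal.ofReal (ε / 2) :=
    h1.trans (ENNReal.div_le_of_le_mul h2)
  rw [Real.dist_eq]
  exact ((ENNReal.ofReal_le_ofReal_iff (half_pos hε).le).1 h3).trans_lt (half_lt_self hε)

/-- A set whose distances to a point fill an interval has large energy, as soon as each of its
points is the centre of a ball with energy at least proportional to the radius. -/
theorem ofReal_mul_le_lintegral_of_forall_ball [MeasurableSpace X] [BorelSpace X]
    [TopologicalSpace.SeparableSpace X] (μ : Measure X) {S : Set X} {x : X} {L R κ : ℝ}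
    (hS : Icc 0 L ⊆ dist x '' S) {f : X → ℝ≥0∞} {D : Set X} (hκ : 0 ≤ κ)
    (h : ∀ z ∈ S, ∃ r, 0 < r ∧ r ≤ R ∧ ball z r ⊆ D ∧
      ENNReal.ofReal (κ * r) ≤ ∫⁻ y in ball z r, f y ∂μ) :
    ENNReal.ofReal (κ * L / 10) ≤ ∫⁻ y in D, f y ∂μ := by
  classical
  choose! rad h0 hR hD hf using h
  obtain ⟨u, huS, hcount, hcov, hsum⟩ :=
    exists_disjoint_ball_cover μ S rad R fun z hz => ⟨h0 z hz, hR z hz⟩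
  have : Countable u := hcount.to_subtype
  have h1 : Icc 0 L ⊆ ⋃ z : u, Icc (dist x z - 5 * rad z) (dist x z + 5 * rad z) := by
    intro t ht
    obtain ⟨w, hw, rfl⟩ := hS ht
    obtain ⟨z, hz, hwz⟩ := mem_iUnion₂.1 (hcov hw)
    refine mem_iUnion.2 ⟨⟨z, hz⟩, ?_⟩
    have h2 := mem_closedBall.1 hwz
    have h3 := dist_triangle x z w
    have h4 := dist_triangle x w z
    rw [dist_comm z w] at h3
    exact ⟨by linarith, by linarith⟩
  have h2 : ENNReal.ofReal L ≤ ∑' z : u, ENNReal.ofReal (10 * rad z) := by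
    calc ENNReal.ofReal L = volume (Icc 0 L) := by rw [Real.volume_Icc, sub_zero]
      _ ≤ ∑' z : u, volume (Icc (dist x z - 5 * rad z) (dist x z + 5 * rad z)) :=
          (measure_mono h1).trans (measure_iUnion_le _)
      _ = _ := by
          refine tsum_congr fun z => ?_
          rw [Real.volume_Icc]
          congr 1; ring
  calc ENNReal.ofReal (κ * L / 10) = ENNReal.ofReal (κ / 10) * ENNReal.ofReal L := by
        rw [← ENNReal.ofReal_mul (by positivity)]; congr 1; ring
    _ ≤ ENNReal.ofReal (κ / 10) * ∑' z : u, ENNReal.ofReal (10 * rad z) := mul_le_mul_right h2 _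
    _ = ∑' z : u, ENNReal.ofReal (κ * rad z) := by
        rw [← ENNReal.tsum_mul_left]
        refine tsum_congr fun z => ?_
        rw [← ENNReal.ofReal_mul (by positivity)]; congr 1; ring
    _ ≤ ∑' z : u, ∫⁻ y in ball (z : X) (rad z), f y ∂μ :=
        ENNReal.tsum_le_tsum fun z => hf z (huS z.2)
    _ ≤ _ := hsum f D fun z hz => hD z (huS hz)

theorem IsPreconnected.Icc_subset_dist_image {E : Set X} (hE : IsPreconnected E) {x z : X}
    (hx : x ∈ E) (hz : z ∈ E) {L : ℝ} (hL : L ≤ dist x z) :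
    Icc 0 L ⊆ dist x '' (E ∩ closedBall x L) := by
  intro t ht
  have h1 : (dist x '' E).OrdConnected :=
    (hE.image (dist x) (by fun_prop)).ordConnected
  obtain ⟨w, hw, rfl⟩ := h1.out (mem_image_of_mem _ hx) (mem_image_of_mem _ hz)
    ⟨by rw [dist_self]; exact ht.1, ht.2.trans hL⟩
  exact ⟨w, ⟨hw, by rw [mem_closedBall']; exact ht.2⟩, rfl⟩

theorem IsCompact.exists_ediam_le_two_mul_dist {E : Set X} (hE : IsCompact E) {x : X}
    (hx : x ∈ E) : ∃ z ∈ E, ediam E ≤ ENNReal.ofReal (2 * dist x z) := by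
  obtain ⟨z, hz, hmax⟩ := hE.exists_isMaxOn ⟨x, hx⟩
    (f := dist x) (by fun_prop)
  refine ⟨z, hz, ediam_le fun a ha b hb => ?_⟩
  rw [edist_dist]
  refine ENNReal.ofReal_le_ofReal ?_
  have h1 : dist x a ≤ dist x z := hmax ha
  have h2 : dist x b ≤ dist x z := hmax hb
  linarith [dist_triangle_left a b x]

variable [MeasurableSpace X] {μ : Measure X} {Q : ℝ}

theorem SupportsPoincare.exists_le_lintegral_rpow (h : SupportsPoincare Q μ)
    (hreg : AhlforsRegular Q μ) (hQ : 0 < Q) :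
    ∃ τ C : ℝ, 0 < τ ∧ 0 < C ∧ ∀ (p q z : X) (r : ℝ), 0 < r → r ≤ 8 * dist p q →
      ∀ u : X → ℝ, Measurable u → ∀ g : X → ℝ≥0∞, Measurable g → IsUpperGradient g u →
        (∫⁻ y in ball z r, ENNReal.ofReal |u y - ⨍ w in ball z r, u w ∂μ| ∂μ) / μ (ball z r) ≤
          ENNReal.ofReal C * (∫⁻ y in ball z (τ * r), g y ^ Q ∂μ) ^ (1 / Q) := by
  obtain ⟨τ, C, hτ, hC, H⟩ := h
  obtain ⟨c, hc, hcb⟩ := hreg.exists_le_measure_ball (K := max 1 (8 * τ)) (le_max_left _ _)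
  refine ⟨τ, C * (c ^ (1 / Q))⁻¹ * τ⁻¹, hτ, by positivity, fun p q z r hr hrd u hu g hg hug => ?_⟩
  refine (H z r hr u hu g hg hug).trans ?_
  have hτr : 0 < τ * r := mul_pos hτ hr
  have h1 : ENNReal.ofReal (c * (τ * r) ^ Q) ≤ μ (ball z (τ * r)) := by
    refine hcb z p q _ hτr ?_
    calc τ * r ≤ τ * (8 * dist p q) := mul_le_mul_of_nonneg_left hrd hτ.le
      _ = 8 * τ * dist p q := by ring
      _ ≤ _ := mul_le_mul_of_nonneg_right (le_max_right _ _) dist_nonneg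
  have hm : 0 < c * (τ * r) ^ Q := by positivity
  have hroot : (c * (τ * r) ^ Q) ^ (1 / Q) = c ^ (1 / Q) * (τ * r) := by
    rw [Real.mul_rpow hc.le (by positivity), ← Real.rpow_mul hτr.le, mul_one_div_cancel hQ.ne',
      Real.rpow_one]
  set I := ∫⁻ y in ball z (τ * r), g y ^ Q ∂μ
  calc ENNReal.ofReal (C * r) * (I / μ (ball z (τ * r))) ^ (1 / Q)
      ≤ ENNReal.ofReal (C * r) * (I / ENNReal.ofReal (c * (τ * r) ^ Q)) ^ (1 / Q) := by
        gcongr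
    _ = ENNReal.ofReal (C * r) * (I ^ (1 / Q) * ENNReal.ofReal (c ^ (1 / Q) * (τ * r))⁻¹) := by
        rw [ENNReal.div_rpow_of_nonneg _ _ (by positivity),
          ENNReal.ofReal_rpow_of_pos hm, hroot, div_eq_mul_inv,
          ENNReal.ofReal_inv_of_pos (by positivity)]
    _ = ENNReal.ofReal (C * (c ^ (1 / Q))⁻¹ * τ⁻¹) * I ^ (1 / Q) := by
        rw [mul_comm (I ^ (1 / Q)), ← mul_assoc, ← ENNReal.ofReal_mul (by positivity)]
        congr 2
        field_simp

variable [BorelSpace X]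

/-- Telescoping of averages over a dyadic sequence of balls shrinking to `z`. -/
theorem abs_sub_setAverage_le_of_dyadic [ProperSpace X] [IsLocallyFiniteMeasure μ]
    {u : X → ℝ} (hu : Continuous u) {x z : X} {R D η s : ℝ} (hR : 0 < R) (hxz : dist x z ≤ 2 * R)
    (hD : 0 ≤ D) (hη : 0 ≤ η) (hs0 : 0 ≤ s) (hs1 : s < 1)
    (hpos : ∀ w r, 0 < r → 0 < μ (ball w r))
    (hdoub : ∀ w r, 0 < r → μ (ball w (8 * r)) ≤ ENNReal.ofReal D * μ (ball w r))
    (hx : (∫⁻ y in ball x (4 * R), ENNReal.ofReal |u y - ⨍ w in ball x (4 * R), u w ∂μ| ∂μ) /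
      μ (ball x (4 * R)) ≤ ENNReal.ofReal η)
    (hz : ∀ k : ℕ, (∫⁻ y in ball z ((1 / 2) ^ k * R),
      ENNReal.ofReal |u y - ⨍ w in ball z ((1 / 2) ^ k * R), u w ∂μ| ∂μ) /
        μ (ball z ((1 / 2) ^ k * R)) ≤ ENNReal.ofReal (η * s ^ k)) :
    |u z - ⨍ w in ball x (4 * R), u w ∂μ| ≤ D * η + D * η / (1 - s) := by
  have hint : ∀ w r, IntegrableOn u (ball w r) μ := fun w r =>
    (hu.continuousOn.integrableOn_compact (isCompact_closedBall w r)).mono_set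
      ball_subset_closedBall
  have hcmp : ∀ (w v : X) (r t ξ : ℝ), 0 < r → 0 ≤ ξ → ball w r ⊆ ball v t →
      ball v t ⊆ ball w (8 * r) →
      (∫⁻ y in ball v t, ENNReal.ofReal |u y - ⨍ w in ball v t, u w ∂μ| ∂μ) / μ (ball v t) ≤
        ENNReal.ofReal ξ →
      |⨍ y in ball w r, u y ∂μ - ⨍ y in ball v t, u y ∂μ| ≤ D * ξ := by
    intro w v r t ξ hr hξ hsub hsub' hosc
    have hfin : ∀ w r, μ (ball w r) ≠ ⊤ := fun w r => measure_ball_lt_top.ne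
    have hv0 : μ (ball v t) ≠ 0 := ((hpos w r hr).trans_le (measure_mono hsub)).ne'
    have h1 := ofReal_abs_setAverage_sub_le (hpos w r hr).ne' (hfin w r) (hint w r)
      (⨍ y in ball v t, u y ∂μ)
    refine (ENNReal.ofReal_le_ofReal_iff (by positivity)).1 (h1.trans ?_)
    refine ENNReal.div_le_of_le_mul ?_
    calc _ ≤ ∫⁻ y in ball v t, ENNReal.ofReal |u y - ⨍ w in ball v t, u w ∂μ| ∂μ :=
          lintegral_mono_set hsub
      _ ≤ ENNReal.ofReal ξ * μ (ball v t) :=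
          (ENNReal.div_le_iff hv0 (hfin v t)).1 hosc
      _ ≤ ENNReal.ofReal ξ * (ENNReal.ofReal D * μ (ball w r)) :=
          mul_le_mul_right ((measure_mono hsub').trans (hdoub w r hr)) _
      _ = _ := by rw [ENNReal.ofReal_mul hD]; ring
  have hrpos : ∀ k : ℕ, 0 < (1 / 2 : ℝ) ^ k * R := fun k => by positivity
  have hstep : ∀ k : ℕ, dist (⨍ y in ball z ((1 / 2) ^ k * R), u y ∂μ)
      (⨍ y in ball z ((1 / 2) ^ (k + 1) * R), u y ∂μ) ≤ D * η * s ^ k := by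
    intro k
    rw [dist_comm, Real.dist_eq, mul_assoc]
    have := hrpos k
    refine hcmp _ _ _ _ _ (hrpos _) (by positivity) (ball_subset_ball ?_) (ball_subset_ball ?_)
      (hz k) <;> rw [pow_succ] <;> linarith
  have hlim : Tendsto (fun k : ℕ => ⨍ y in ball z ((1 / 2) ^ k * R), u y ∂μ) atTop
      (nhds (u z)) := by
    refine tendsto_setAverage_ball hu z ?_ fun k => hpos _ _ (hrpos k)
    simpa using (_root_.tendsto_pow_atTop_nhds_zero_of_lt_one (r := (1 / 2 : ℝ)) (by norm_num)
      (by norm_num)).mul_const R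
  have h1 := dist_le_of_le_geometric_of_tendsto₀ s (D * η) hs1 hstep hlim
  have h2 := hcmp z x ((1 / 2) ^ 0 * R) (4 * R) η (hrpos 0) hη
    (ball_subset_ball' (by rw [dist_comm]; simp; linarith))
    (ball_subset_ball' (by simp; linarith)) hx
  rw [dist_comm, Real.dist_eq] at h1
  linarith [abs_sub_le (u z) (⨍ y in ball z ((1 / 2) ^ 0 * R), u y ∂μ)
    (⨍ y in ball x (4 * R), u y ∂μ)]

/-- Lower bound for the energy of an upper gradient of a function separating two sets whose
distances to a base point fill an interval of length `L`. -/
theorem SupportsPoincare.exists_ofReal_le_lintegral_rpow [Nontrivial X] [ProperSpace X]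
    [IsLocallyFiniteMeasure μ] (h : SupportsPoincare Q μ) (hreg : AhlforsRegular Q μ)
    (hQ : 0 < Q) :
    ∃ τ c : ℝ, 0 < τ ∧ 0 < c ∧ ∀ (p q x y : X) (R L : ℝ), 0 < R → R ≤ 2 * dist p q → 0 ≤ L →
      L ≤ R → dist x y ≤ R → ∀ E F : Set X, Icc 0 L ⊆ dist x '' (E ∩ closedBall x L) →
      Icc 0 L ⊆ dist y '' (F ∩ closedBall y L) → ∀ u : X → ℝ, Continuous u →
      (∀ z ∈ E, u z = 0) → (∀ z ∈ F, 3 / 4 ≤ u z) → ∀ g : X → ℝ≥0∞, Measurable g →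
      IsUpperGradient g u →
      ENNReal.ofReal (c * (L / R)) ≤ ∫⁻ w in ball x (4 * (τ + 1) * R), g w ^ Q ∂μ := by
  obtain ⟨τ, C, hτ, hC, H⟩ := h.exists_le_lintegral_rpow hreg hQ
  obtain ⟨D, hD1, hdoub⟩ := hreg.exists_doubling hQ.le (τ := 8) (by norm_num)
  have hD : 0 < D := one_pos.trans_le hD1
  set s : ℝ := (1 / 2) ^ (1 / Q) with hs
  have hs0 : 0 < s := by positivity
  have hs1 : s < 1 := Real.rpow_lt_one (by norm_num) (by norm_num) (by positivity)
  have hsQ : s ^ Q = 1 / 2 := by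
    rw [hs, ← Real.rpow_mul (by norm_num), one_div_mul_cancel hQ.ne', Real.rpow_one]
  have h1s : 0 < 1 - s := sub_pos.2 hs1
  set a : ℝ := (8 * D * C * (1 + 1 / (1 - s)))⁻¹ with ha
  have ha0 : 0 < a := by positivity
  have haeq : D * (C * a) + D * (C * a) / (1 - s) = 1 / 8 := by
    rw [ha]; field_simp
  have haQ : 0 < a ^ Q := by positivity
  refine ⟨τ, min (a ^ Q) (a ^ Q / (10 * τ)), hτ, by positivity, ?_⟩
  intro p q x y R L hR hRd hL hLR hxy E F hE hF u hu huE huF g hg hug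
  have hLR1 : L / R ≤ 1 := (div_le_one hR).2 hLR
  have hLR0 : 0 ≤ L / R := div_nonneg hL hR.le
  by_cases hbig : ∫⁻ w in ball x (τ * (4 * R)), g w ^ Q ∂μ ≤ ENNReal.ofReal (a ^ Q)
  swap
  · refine le_trans (ENNReal.ofReal_le_ofReal ?_) ((not_le.1 hbig).le.trans
      (lintegral_mono_set (ball_subset_ball (by nlinarith))))
    calc _ ≤ a ^ Q * 1 := mul_le_mul (min_le_left _ _) hLR1 hLR0 haQ.le
      _ = _ := mul_one _
  have hroot : ∀ (b : ℝ) (I : ℝ≥0∞), 0 ≤ b → I ≤ ENNReal.ofReal (b ^ Q) →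
      ENNReal.ofReal C * I ^ (1 / Q) ≤ ENNReal.ofReal (C * b) := by
    intro b I hb hI
    rw [ENNReal.ofReal_mul hC.le]
    refine mul_le_mul_right ?_ _
    rw [one_div, ENNReal.rpow_inv_le_iff hQ, ENNReal.ofReal_rpow_of_nonneg hb hQ.le]
    exact hI
  have hgood : ∀ z, dist x z ≤ 2 * R → (∀ k : ℕ,
      ∫⁻ w in ball z (τ * ((1 / 2) ^ k * R)), g w ^ Q ∂μ ≤ ENNReal.ofReal ((a * s ^ k) ^ Q)) →
      |u z - ⨍ w in ball x (4 * R), u w ∂μ| ≤ 1 / 8 := by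
    intro z hz hk
    rw [← haeq]
    refine abs_sub_setAverage_le_of_dyadic hu hR hz hD.le (by positivity) hs0.le hs1
      (fun w r hr => hreg.measure_ball_pos w hr) hdoub ?_ fun k => ?_
    · exact (H p q x (4 * R) (by positivity) (by linarith) u hu.measurable g hg hug).trans
        (hroot a _ ha0.le hbig)
    · have h2 : (1 / 2 : ℝ) ^ k ≤ 1 := pow_le_one₀ (by norm_num) (by norm_num)
      rw [mul_assoc]
      refine (H p q z ((1 / 2) ^ k * R) (by positivity) ?_ u hu.measurable g hg hug).trans
        (hroot _ _ (by positivity) (hk k))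
      nlinarith [dist_nonneg (x := p) (y := q)]
  have hbad : ∀ z, dist x z ≤ 2 * R → 1 / 8 < |u z - ⨍ w in ball x (4 * R), u w ∂μ| →
      ∃ r, 0 < r ∧ r ≤ τ * R ∧ ball z r ⊆ ball x (4 * (τ + 1) * R) ∧
        ENNReal.ofReal (a ^ Q / (τ * R) * r) ≤ ∫⁻ w in ball z r, g w ^ Q ∂μ := by
    intro z hz hzu
    have h1 := mt (hgood z hz) (not_le.2 hzu)
    push Not at h1
    obtain ⟨k, hk⟩ := h1
    have h2 : (1 / 2 : ℝ) ^ k ≤ 1 := pow_le_one₀ (by norm_num) (by norm_num)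
    have h3 : τ * ((1 / 2) ^ k * R) ≤ τ * R :=
      mul_le_mul_of_nonneg_left (by nlinarith) hτ.le
    refine ⟨τ * ((1 / 2) ^ k * R), by positivity, h3, ball_subset_ball' ?_,
      le_trans (ENNReal.ofReal_le_ofReal (le_of_eq ?_)) hk.le⟩
    · rw [dist_comm]; nlinarith [mul_pos hτ hR]
    · rw [Real.mul_rpow ha0.le (by positivity), ← Real.rpow_natCast s, ← Real.rpow_mul hs0.le,
        mul_comm (k : ℝ), Real.rpow_mul hs0.le, hsQ, Real.rpow_natCast]
      field_simp
  have hfin : ∀ (v : X) (S : Set X), Icc 0 L ⊆ dist v '' S →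
      (∀ z ∈ S, dist x z ≤ 2 * R ∧ 1 / 8 < |u z - ⨍ w in ball x (4 * R), u w ∂μ|) →
      ENNReal.ofReal (min (a ^ Q) (a ^ Q / (10 * τ)) * (L / R)) ≤
        ∫⁻ w in ball x (4 * (τ + 1) * R), g w ^ Q ∂μ := by
    intro v S hS hSu
    refine le_trans (ENNReal.ofReal_le_ofReal ?_)
      (ofReal_mul_le_lintegral_of_forall_ball (κ := a ^ Q / (τ * R)) μ hS (by positivity)
        fun z hz => hbad z (hSu z hz).1 (hSu z hz).2)
    calc _ ≤ a ^ Q / (10 * τ) * (L / R) := mul_le_mul_of_nonneg_right (min_le_right _ _) hLR0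
      _ = _ := by field_simp
  by_cases hall : ∀ z ∈ E ∩ closedBall x L, 1 / 8 < |u z - ⨍ w in ball x (4 * R), u w ∂μ|
  · exact hfin x _ hE fun z hz => ⟨by linarith [mem_closedBall'.1 hz.2], hall z hz⟩
  · push Not at hall
    obtain ⟨z, hz, hzu⟩ := hall
    rw [huE z hz.1] at hzu
    refine hfin y _ hF fun w hw =>
      ⟨by linarith [mem_closedBall'.1 hw.2, dist_triangle x y w], ?_⟩
    have h1 := huF w hw.1
    rw [lt_abs]
    left
    linarith [(abs_le.1 hzu).1]

theorem SupportsPoincare.isLoewner [ProperSpace X] [IsLocallyFiniteMeasure μ]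
    (h : SupportsPoincare Q μ) (hreg : AhlforsRegular Q μ) (hQ : 0 < Q) : IsLoewner Q X μ := by
  rcases subsingleton_or_nontrivial X with hX | hX
  · exact ⟨fun _ => 1, fun _ _ _ _ => le_rfl, fun _ _ => ⟨one_pos, ENNReal.one_lt_top⟩,
      fun E _ _ hE => absurd hE (not_nontrivial_iff.2 (subsingleton_of_subsingleton))⟩
  obtain ⟨τ, c, hτ, hc, H⟩ := h.exists_ofReal_le_lintegral_rpow hreg hQ
  refine ⟨fun t => ENNReal.ofReal (c / (2 * (1 + 2 * t))), fun s t hs hst => ?_,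
    fun t ht => ⟨ENNReal.ofReal_pos.2 (by positivity), ENNReal.ofReal_lt_top⟩, ?_⟩
  · refine ENNReal.ofReal_le_ofReal (div_le_div_of_nonneg_left hc.le (by positivity) (by linarith))
  intro E F hE hEn hF hFn hdisj t ht hEF
  refine le_iInf fun ρ => le_iInf fun hρ => le_iInf fun hadm => ?_
  have hEd : ediam E ≠ ⊤ := hE.1.isBounded.ediam_ne_top
  have hm0 : min (ediam E) (ediam F) ≠ 0 :=
    (lt_min (ediam_pos_iff.2 hEn) (ediam_pos_iff.2 hFn)).ne'
  have hmt : min (ediam E) (ediam F) ≠ ⊤ := ne_top_of_le_ne_top hEd (min_le_left _ _)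
  set d := (min (ediam E) (ediam F)).toReal with hd
  have hde : ENNReal.ofReal d = min (ediam E) (ediam F) := ENNReal.ofReal_toReal hmt
  have hd0 : 0 < d := ENNReal.toReal_pos hm0 hmt
  obtain ⟨x, hx, y, hy, hxy⟩ : ∃ x ∈ E, ∃ y ∈ F, dist x y < 2 * t * d := by
    have h1 : setEDist E F < ENNReal.ofReal (2 * t * d) := by
      refine lt_of_le_of_lt hEF ?_
      change ENNReal.ofReal t * min (ediam E) (ediam F) < _
      rw [← hde, ← ENNReal.ofReal_mul ht.le]
      exact (ENNReal.ofReal_lt_ofReal_iff (by positivity)).2 (by nlinarith [mul_pos ht hd0])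
    simp only [setEDist, iInf_lt_iff] at h1
    obtain ⟨x, hx, h2⟩ := h1
    obtain ⟨y, hy, h3⟩ := infEDist_lt_iff.1 h2
    rw [edist_dist] at h3
    exact ⟨x, hx, y, hy, (ENNReal.ofReal_lt_ofReal_iff (by positivity)).1 h3⟩
  have hpt : ∀ (G : Set X) (v : X), IsCompact G → v ∈ G → ENNReal.ofReal d ≤ ediam G →
      ∃ z ∈ G, d / 2 ≤ dist v z := by
    intro G v hG hv hdG
    obtain ⟨z, hz, hvz⟩ := hG.exists_ediam_le_two_mul_dist hv
    have := (ENNReal.ofReal_le_ofReal_iff (by positivity)).1 (hdG.trans hvz)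
    exact ⟨z, hz, by linarith⟩
  obtain ⟨p, hp, hxp⟩ := hpt E x hE.1 hx (hde.trans_le (min_le_left _ _))
  obtain ⟨q, hq, hyq⟩ := hpt F y hF.1 hy (hde.trans_le (min_le_right _ _))
  set R := max d (dist x y) with hR
  have hdR : d ≤ R := le_max_left _ _
  have hR0 : 0 < R := hd0.trans_le hdR
  have hRt : R ≤ (1 + 2 * t) * d := max_le (by nlinarith [mul_pos ht hd0]) (by linarith)
  obtain ⟨v, w, hvw⟩ : ∃ v w : X, R ≤ 2 * dist v w := by
    rcases max_choice d (dist x y) with h1 | h1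
    · exact ⟨x, p, by rw [hR, h1]; linarith⟩
    · exact ⟨x, y, by rw [hR, h1]; linarith [dist_nonneg (x := x) (y := y)]⟩
  have hkey : ENNReal.ofReal (c / (2 * (1 + 2 * t))) ≤ ENNReal.ofReal (c * (d / 2 / R)) := by
    refine ENNReal.ofReal_le_ofReal ?_
    rw [div_div, ← mul_div_assoc, div_le_div_iff₀ (by positivity) (by positivity)]
    nlinarith [mul_le_mul_of_nonneg_left hRt hc.le]
  refine hkey.trans (le_trans ?_ (setLIntegral_le_lintegral (ball x (4 * (τ + 1) * R)) _))
  refine le_of_forall_gt_imp_ge_of_dense fun J hJ => ?_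
  obtain ⟨σ, hσl, hρσ, ⟨ε, hε, hεσ⟩, hσJ⟩ := exists_lowerSemicontinuous_majorant μ hQ hρ x _ hJ
  refine le_trans ?_ hσJ
  obtain ⟨n, hn⟩ : ∃ n : ℕ, ∀ z ∈ F, 3 / 4 ≤ chainDist σ (1 / ((n : ℝ) + 1)) E 1 z := by
    by_contra! hcon
    obtain ⟨γ, L, hL, hγc, hγ0, hγL, -, hγ⟩ := exists_curve_of_chainCost_lt (A := 7 / 8) hσl hε hεσ
      hE.1 hF.1.isClosed (by norm_num) fun n => by
        obtain ⟨z, hz, hlt⟩ := hcon n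
        refine ⟨z, hz, (chainCost_le_of_chainDist_le (by norm_num) hlt.le).trans_lt ?_⟩
        exact (ENNReal.ofReal_lt_ofReal_iff (by norm_num)).2 (by norm_num)
    have h1 : 1 ≤ γ.lineIntegral ρ := hadm γ ⟨subset_univ _,
      ⟨0, by rw [hγc]; exact left_mem_Icc.2 hL, hγ0⟩, L, by rw [hγc]; exact right_mem_Icc.2 hL, hγL⟩
    have h2 := (h1.trans (γ.lineIntegral_mono fun s _ => hρσ (γ.toFun s))).trans hγ
    rw [ENNReal.one_le_ofReal] at h2
    norm_num at h2
  have hδ : (0 : ℝ) < 1 / ((n : ℝ) + 1) := by positivity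
  refine H v w x y R (d / 2) hR0 hvw (by positivity) (by linarith) (le_max_right _ _) E F
    (hE.2.isPreconnected.Icc_subset_dist_image hx hp hxp)
    (hF.2.isPreconnected.Icc_subset_dist_image hy hq hyq)
    (chainDist σ (1 / ((n : ℝ) + 1)) E 1) (continuous_chainDist σ hδ E 1)
    (fun z hz => chainDist_eq_zero _ _ _ hz) hn σ hσl.measurable ?_
  intro γ a b hab hγ _ _
  exact ofReal_abs_chainDist_sub_le_lineIntegral σ hδ E 1 γ (hγ ▸ left_mem_Icc.2 hab)
    (hγ ▸ right_mem_Icc.2 hab)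

end PoincareToLoewner

/-- a proper, quasiconvex, Ahlfors `Q`-regular metric measure space (`Q > 1`) is
`Q`-Loewner if and only if it supports a `Q`-Poincaré inequality. -/
theorem loewner_iff_poincare
    {X : Type*} [MetricSpace X] [TopologicalSpace.SeparableSpace X] [ProperSpace X]
    [MeasurableSpace X] [BorelSpace X]
    (μ : Measure X) [IsLocallyFiniteMeasure μ] (Q : ℝ) (hQ : 1 < Q)
    (hconv : IsQuasiconvexSpace X) (hreg : AhlforsRegular Q μ) :
    IsLoewner Q X μ ↔ SupportsPoincare Q μ :=
  ⟨fun h => h.supportsPoincare hconv hreg hQ, fun h => h.isLoewner hreg (one_pos.trans hQ)⟩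
end
end
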